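/- arXiv:1310.0807 — 2 statements merged into one kernel-verified Lean document; each statement's English description precedes it below -/
import Mathlib

section
/- There exists a universal constant C > 0 such that the following holds for all n ≥ 2, r ≥ 1, and m ≥ 1. Let B_1, …, B_m ∈ ℝ^{n×n} be fixed symmetric matrices with spectral norm ‖B_i‖ ≤ K for all i, where K ≤ n², and let g_1, …, g_m be i.i.d. standard Gaussian random variables. For a matrix M of rank at most r with reduced SVD M = UΛV^T, write P_T for the orthogonal projection of ℝ^{n×n} onto its tangent space T = {U M_1 + M_2 V^T}, and let M_r^t be the collection of all such tangent spaces as M ranges over matrices of rank at most r. Then E[ sup_{T ∈ M_r^t} ‖ P_T ( Σ_{i=1}^m g_i · B_i ⟨B_i, ·⟩ ) P_T ‖ ] ≤ C·√r·K·(log n)³ · sup_{T ∈ M_r^t} √( ‖ Σ_{i=1}^m P_T (B_i ⟨B_i, ·⟩) P_T ‖ ), where ‖·‖ on operators is the operator norm with respect to the Frobenius norm on ℝ^{n×n} and B_i ⟨B_i, ·⟩ denotes the linear map X ↦ B_i·⟨B_i, X⟩. -/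
open MeasureTheory ProbabilityTheory Matrix

noncomputable section

/-- Frobenius norm of a real square matrix. -/
def frobNorm {n : ℕ} (X : Matrix (Fin n) (Fin n) ℝ) : ℝ :=
  Real.sqrt (∑ i, ∑ j, X i j ^ 2)

/-- Frobenius inner product `⟨Y, X⟩ = trace (Yᵀ X)`. -/
def finner {n : ℕ} (Y X : Matrix (Fin n) (Fin n) ℝ) : ℝ := ∑ i, ∑ j, Y i j * X i j

/-- Spectral norm: the largest singular value of `X`. -/
def specNorm {n : ℕ} (X : Matrix (Fin n) (Fin n) ℝ) : ℝ :=
  ⨆ i, Real.sqrt ((Matrix.posSemidef_conjTranspose_mul_self X).1.eigenvalues i)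

/-- Operator norm of a map on `n × n` matrices, with respect to the Frobenius norm. -/
def opNormFrob {n : ℕ} (L : Matrix (Fin n) (Fin n) ℝ → Matrix (Fin n) (Fin n) ℝ) : ℝ :=
  ⨆ X : {X : Matrix (Fin n) (Fin n) ℝ // frobNorm X ≤ 1}, frobNorm (L X.1)

/-- The matrix of the orthogonal projection of Euclidean space onto the column space
of `M`. -/
def colProjMat {n : ℕ} (M : Matrix (Fin n) (Fin n) ℝ) : Matrix (Fin n) (Fin n) ℝ :=
  Matrix.toEuclideanLin.symm
    ((LinearMap.range (Matrix.toEuclideanLin M)).subtype ∘ₗ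
      (Submodule.orthogonalProjectionOnto (LinearMap.range (Matrix.toEuclideanLin M))).toLinearMap)

/-- The orthogonal projection `P_T` onto the tangent space
`T = {U M₁ + M₂ Vᵀ}` at `M` (where `U`, `V` span the column and row spaces of `M`):
`P_T(X) = P_col X + X P_row − P_col X P_row`. -/
def tangentProj {n : ℕ} (M X : Matrix (Fin n) (Fin n) ℝ) : Matrix (Fin n) (Fin n) ℝ :=
  colProjMat M * X + X * colProjMat Mᵀ - colProjMat M * X * colProjMat Mᵀ

section GaussianMax

variable {Ω : Type} [MeasurableSpace Ω] {P : Measure Ω} {m : ℕ}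
  {g : Fin m → Ω → ℝ}

/-- The exponential moment of a linear combination of independent standard Gaussians. -/
lemma gaussian_exp_moment (hg : ∀ i, Measurable (g i)) (hind : iIndepFun g P)
    (hlaw : ∀ i, Measure.map (g i) P = gaussianReal 0 1) (c : Fin m → ℝ) :
    Integrable (fun ω => Real.exp (∑ i, g i ω * c i)) P ∧
      ∫ ω, Real.exp (∑ i, g i ω * c i) ∂P = Real.exp ((∑ i, c i ^ 2) / 2) := by
  have hmeas : ∀ i, Measurable (fun ω => g i ω * c i) := fun i => (hg i).mul_const _
  have hind' : iIndepFun (fun i ω => g i ω * c i) P :=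
    hind.comp (fun i x => x * c i) (fun i => measurable_id.mul_const _)
  have hmgf : ∀ i, mgf (fun ω => g i ω * c i) P 1 = Real.exp (c i ^ 2 / 2) := by
    intro i
    have h := mgf_gaussianReal (hlaw i) (c i)
    simp only [NNReal.coe_one, zero_mul, one_mul, zero_add] at h
    rw [← h]
    simp only [mgf, one_mul, mul_comm (c i)]
  have hprod : mgf (∑ i, fun ω => g i ω * c i) P 1 = Real.exp ((∑ i, c i ^ 2) / 2) := by
    rw [hind'.mgf_sum hmeas, Finset.prod_congr rfl (fun i _ => hmgf i), ← Real.exp_sum,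
      Finset.sum_div]
  have heq : mgf (∑ i, fun ω => g i ω * c i) P 1 = ∫ ω, Real.exp (∑ i, g i ω * c i) ∂P := by
    simp [mgf, Finset.sum_apply]
  rw [heq] at hprod
  refine ⟨?_, hprod⟩
  by_contra hni
  rw [integral_undef hni] at hprod
  exact (Real.exp_pos _).ne hprod

/-- A finite family of Gaussian linear combinations with standard deviations at most `σ` is
dominated by an integrable function whose mean is of order `σ √(log N)`. -/
lemma gaussian_max_dominated [IsProbabilityMeasure P] (hg : ∀ i, Measurable (g i))
    (hind : iIndepFun g P)
    (hlaw : ∀ i, Measure.map (g i) P = gaussianReal 0 1) {κ : Type*} (s : Finset κ)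
    (c : κ → Fin m → ℝ) {σ L : ℝ} (hσ : 0 ≤ σ) (hL : 0 < L)
    (hcard : Real.log (2 * (s.card : ℝ)) ≤ L ^ 2) (hc : ∀ k ∈ s, ∑ i, c k i ^ 2 ≤ σ ^ 2) :
    ∃ G : Ω → ℝ, Integrable G P ∧ ∫ ω, G ω ∂P ≤ 2 * σ * L ∧
      ∀ ω, ∀ k ∈ s, |∑ i, g i ω * c k i| ≤ G ω := by
  rcases hσ.eq_or_lt with rfl | hσ
  · refine ⟨0, integrable_zero _ _ _, by simp, fun ω k hk => ?_⟩
    have h0 : ∑ i, c k i ^ 2 = 0 :=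
      le_antisymm (by simpa using hc k hk) (Finset.sum_nonneg fun i _ => sq_nonneg _)
    have h1 := (Finset.sum_eq_zero_iff_of_nonneg (fun i _ => sq_nonneg (c k i))).1 h0
    have h2 : ∀ i, c k i = 0 := fun i => by simpa using h1 i (Finset.mem_univ i)
    simp [h2]
  have hexp := gaussian_exp_moment (P := P) hg hind hlaw
  set t : ℝ := L / σ with ht
  have htpos : 0 < t := div_pos hL hσ
  set E : ℝ := 3 / 2 * L ^ 2 with hE
  let F : κ → Ω → ℝ := fun k ω =>
    Real.exp (∑ i, g i ω * (t * c k i)) + Real.exp (∑ i, g i ω * (-t * c k i))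
  have hF : ∀ k ∈ s, Integrable (F k) P := fun k _ => (hexp _).1.add (hexp _).1
  have hFint : ∀ k ∈ s, ∫ ω, F k ω ∂P ≤ 2 * Real.exp (L ^ 2 / 2) := by
    intro k hk
    simp only [F]
    rw [integral_add (hexp _).1 (hexp _).1, (hexp _).2, (hexp _).2]
    have hle : t ^ 2 * ∑ i, c k i ^ 2 ≤ L ^ 2 := by
      calc t ^ 2 * ∑ i, c k i ^ 2 ≤ t ^ 2 * σ ^ 2 := by gcongr; exact hc k hk
        _ = L ^ 2 := by rw [ht]; field_simp
    have e1 : ∑ i, (t * c k i) ^ 2 = t ^ 2 * ∑ i, c k i ^ 2 := by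
      rw [Finset.mul_sum]; exact Finset.sum_congr rfl fun i _ => by ring
    have e2 : ∑ i, (-t * c k i) ^ 2 = t ^ 2 * ∑ i, c k i ^ 2 := by
      rw [Finset.mul_sum]; exact Finset.sum_congr rfl fun i _ => by ring
    rw [e1, e2]
    have := Real.exp_le_exp.2 (div_le_div_of_nonneg_right hle (by norm_num : (0 : ℝ) ≤ 2))
    linarith
  have hsum : Integrable (fun ω => ∑ k ∈ s, F k ω) P := integrable_finsetSum _ hF
  refine ⟨fun ω => t⁻¹ * (E - 1 + Real.exp (-E) * ∑ k ∈ s, F k ω), ?_, ?_, ?_⟩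
  · exact ((integrable_const _).add (hsum.const_mul _)).const_mul _
  · rw [integral_const_mul, integral_add (integrable_const _) (hsum.const_mul _),
      integral_const_mul, integral_finsetSum _ hF]
    have h1 : ∑ k ∈ s, ∫ ω, F k ω ∂P ≤ Real.exp E := by
      calc ∑ k ∈ s, ∫ ω, F k ω ∂P ≤ ∑ k ∈ s, 2 * Real.exp (L ^ 2 / 2) := Finset.sum_le_sum hFint
        _ = (2 * (s.card : ℝ)) * Real.exp (L ^ 2 / 2) := by
          rw [Finset.sum_const, nsmul_eq_mul]; ring
        _ ≤ Real.exp (L ^ 2) * Real.exp (L ^ 2 / 2) := by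
          gcongr
          rcases (by positivity : (0 : ℝ) ≤ 2 * (s.card : ℝ)).eq_or_lt with h0 | h0
          · rw [← h0]; exact (Real.exp_pos _).le
          · exact (Real.log_le_iff_le_exp h0).1 hcard
        _ = Real.exp E := by rw [← Real.exp_add, hE]; congr 1; ring
    have h2 : Real.exp (-E) * ∑ k ∈ s, ∫ ω, F k ω ∂P ≤ 1 := by
      calc _ ≤ Real.exp (-E) * Real.exp E := by gcongr
        _ = 1 := by rw [← Real.exp_add]; simp
    calc t⁻¹ * (∫ _, (E - 1) ∂P + Real.exp (-E) * ∑ k ∈ s, ∫ ω, F k ω ∂P)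
        ≤ t⁻¹ * E := by
          gcongr
          simp only [integral_const, probReal_univ, smul_eq_mul, one_mul]
          linarith
      _ = 3 / 2 * (σ * L) := by rw [ht, hE]; field_simp
      _ ≤ 2 * σ * L := by nlinarith [mul_pos hσ hL]
  · intro ω k hk
    rw [le_inv_mul_iff₀ htpos]
    have hpos : ∀ k, 0 ≤ F k ω := fun k => by positivity
    have h1 : Real.exp (t * |∑ i, g i ω * c k i|) ≤ F k ω := by
      have e1 : ∑ i, g i ω * (t * c k i) = t * ∑ i, g i ω * c k i := by
        rw [Finset.mul_sum]; exact Finset.sum_congr rfl fun i _ => by ring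
      have e2 : ∑ i, g i ω * (-t * c k i) = t * -∑ i, g i ω * c k i := by
        rw [← Finset.sum_neg_distrib, Finset.mul_sum]
        exact Finset.sum_congr rfl fun i _ => by ring
      simp only [F]
      rw [e1, e2]
      rcases abs_choice (∑ i, g i ω * c k i) with h | h <;> rw [h]
      · exact le_add_of_nonneg_right (Real.exp_pos _).le
      · exact le_add_of_nonneg_left (Real.exp_pos _).le
    have h2 : F k ω ≤ ∑ k ∈ s, F k ω := Finset.single_le_sum (fun k _ => hpos k) hk
    have h3 := Real.add_one_le_exp (t * |∑ i, g i ω * c k i| - E)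
    have h4 : Real.exp (t * |∑ i, g i ω * c k i| - E) ≤ Real.exp (-E) * ∑ k ∈ s, F k ω := by
      rw [sub_eq_neg_add, Real.exp_add]
      gcongr
      exact h1.trans h2
    linarith

end GaussianMax

section TracePotential

variable {n : ℕ}

/-- `b` bounds the operator norm of `A` on Euclidean space. -/
def OpBound (A : Matrix (Fin n) (Fin n) ℝ) (b : ℝ) : Prop :=
  ∀ v : Fin n → ℝ, (A *ᵥ v) ⬝ᵥ (A *ᵥ v) ≤ b ^ 2 * (v ⬝ᵥ v)

/-- Real symmetric matrices are orthogonally diagonalizable. -/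
lemma exists_orthogonal_diagonalization {M : Matrix (Fin n) (Fin n) ℝ} (hM : M.IsSymm) :
    ∃ (U : Matrix (Fin n) (Fin n) ℝ) (d : Fin n → ℝ),
      Uᵀ * U = 1 ∧ U * Uᵀ = 1 ∧ M = U * diagonal d * Uᵀ := by
  have hH : M.IsHermitian := by
    rw [Matrix.IsHermitian, conjTranspose_eq_transpose_of_trivial]; exact hM
  have hs := hH.spectral_theorem
  rw [Unitary.conjStarAlgAut_apply] at hs
  have hst : ∀ A : Matrix (Fin n) (Fin n) ℝ, star A = Aᵀ := fun A => by
    rw [star_eq_conjTranspose, conjTranspose_eq_transpose_of_trivial]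
  refine ⟨hH.eigenvectorUnitary, hH.eigenvalues, ?_, ?_, ?_⟩
  · rw [← hst]; exact Unitary.coe_star_mul_self _
  · rw [← hst]; exact Unitary.coe_mul_star_self _
  · rw [← hst]; exact hs

lemma pow_diagonalized {U : Matrix (Fin n) (Fin n) ℝ} (hU : Uᵀ * U = 1) (hU' : U * Uᵀ = 1)
    (d : Fin n → ℝ) (k : ℕ) :
    (U * diagonal d * Uᵀ) ^ k = U * diagonal (fun a => d a ^ k) * Uᵀ := by
  induction k with
  | zero => simp [hU']
  | succ k ih =>
    rw [pow_succ, ih]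
    calc U * diagonal (fun a => d a ^ k) * Uᵀ * (U * diagonal d * Uᵀ)
        = U * diagonal (fun a => d a ^ k) * (Uᵀ * U) * diagonal d * Uᵀ := by
          simp only [Matrix.mul_assoc]
      _ = U * diagonal (fun a => d a ^ (k + 1)) * Uᵀ := by
          rw [hU, Matrix.mul_one, Matrix.mul_assoc U, diagonal_mul_diagonal]
          simp only [pow_succ]

lemma trace_pow_diagonalized {U : Matrix (Fin n) (Fin n) ℝ} (hU : Uᵀ * U = 1)
    (hU' : U * Uᵀ = 1) (d : Fin n → ℝ) (k : ℕ) :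
    trace ((U * diagonal d * Uᵀ) ^ k) = ∑ a, d a ^ k := by
  rw [pow_diagonalized hU hU', trace_mul_comm, ← Matrix.mul_assoc, hU, Matrix.one_mul,
    trace_diagonal]

lemma trace_pow_even_nonneg {M : Matrix (Fin n) (Fin n) ℝ} (hM : M.IsSymm) (q : ℕ) :
    0 ≤ trace (M ^ (2 * q)) := by
  obtain ⟨U, d, hU, hU', rfl⟩ := exists_orthogonal_diagonalization hM
  rw [trace_pow_diagonalized hU hU']
  exact Finset.sum_nonneg fun a _ => by rw [pow_mul]; positivity

lemma pow_mul_pow_add_le (x y : ℝ) (q i : ℕ) (hi : i ≤ 2 * q) :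
    x ^ (2 * q - i) * y ^ i + x ^ i * y ^ (2 * q - i) ≤ x ^ (2 * q) + y ^ (2 * q) := by
  obtain ⟨j, hj⟩ := Nat.exists_eq_add_of_le hi
  have hji : 2 * q - i = j := by omega
  rw [hji]
  have key : ∀ a b : ℝ, 0 ≤ a → 0 ≤ b →
      a ^ j * b ^ i + a ^ i * b ^ j ≤ a ^ (i + j) + b ^ (i + j) := by
    intro a b ha hb
    have : 0 ≤ (a ^ i - b ^ i) * (a ^ j - b ^ j) := by
      rcases le_total a b with h | h
      · exact mul_nonneg_of_nonpos_of_nonpos (sub_nonpos.2 (pow_le_pow_left₀ ha h i))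
          (sub_nonpos.2 (pow_le_pow_left₀ ha h j))
      · exact mul_nonneg (sub_nonneg.2 (pow_le_pow_left₀ hb h i))
          (sub_nonneg.2 (pow_le_pow_left₀ hb h j))
    rw [pow_add, pow_add]
    nlinarith
  have h := key |x| |y| (abs_nonneg _) (abs_nonneg _)
  have e1 : ∀ z : ℝ, |z| ^ (i + j) = z ^ (2 * q) := fun z => by
    rw [← hj, pow_mul, sq_abs, ← pow_mul]
  rw [e1, e1] at h
  refine le_trans (add_le_add ?_ ?_) h
  · rw [← abs_pow, ← abs_pow, ← abs_mul]; exact le_abs_self _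
  · rw [← abs_pow, ← abs_pow, ← abs_mul]; exact le_abs_self _

/-- The second-order trace inequality behind the smoothness of `tr cosh`. -/
lemma sum_trace_pow_mul_le {M H : Matrix (Fin n) (Fin n) ℝ} (hM : M.IsSymm) (hH : H.IsSymm)
    {K : ℝ} (hK : OpBound H K) (q : ℕ) :
    ∑ i ∈ Finset.range (2 * q + 1), trace (M ^ (2 * q - i) * H * M ^ i * H) ≤
      (2 * q + 1) * K ^ 2 * trace (M ^ (2 * q)) := by
  obtain ⟨U, d, hU, hU', rfl⟩ := exists_orthogonal_diagonalization hM
  set G : Matrix (Fin n) (Fin n) ℝ := Uᵀ * H * U with hG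
  have hGs : Gᵀ = G := by
    rw [hG, transpose_mul, transpose_mul, transpose_transpose, hH.eq, Matrix.mul_assoc]
  have hGab : ∀ a b, G b a = G a b := fun a b => congrFun (congrFun hGs a) b
  have hterm : ∀ j k, trace ((U * diagonal d * Uᵀ) ^ j * H * (U * diagonal d * Uᵀ) ^ k * H) =
      ∑ a, ∑ b, G a b ^ 2 * (d a ^ j * d b ^ k) := by
    intro j k
    rw [pow_diagonalized hU hU', pow_diagonalized hU hU']
    have : trace (U * diagonal (fun a => d a ^ j) * Uᵀ * H *
        (U * diagonal (fun a => d a ^ k) * Uᵀ) * H) =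
        trace (diagonal (fun a => d a ^ j) * G * (diagonal (fun a => d a ^ k) * G)) := by
      rw [hG]
      simp only [Matrix.mul_assoc]
      rw [trace_mul_comm]
      simp only [Matrix.mul_assoc]
    rw [this, trace]
    refine Finset.sum_congr rfl fun a _ => ?_
    rw [diag_apply, mul_apply]
    refine Finset.sum_congr rfl fun b _ => ?_
    rw [diagonal_mul, diagonal_mul, hGab a b]
    ring
  have hrow : ∀ a, ∑ b, G a b ^ 2 ≤ K ^ 2 := by
    intro a
    have h := hK (fun i => U i a)
    have h1 : (fun i => U i a) ⬝ᵥ (fun i => U i a) = 1 := by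
      have := congrFun (congrFun hU a) a
      rw [mul_apply, one_apply_eq] at this
      simpa [dotProduct] using this
    have h2 : (G * G) a a = (H *ᵥ fun i => U i a) ⬝ᵥ (H *ᵥ fun i => U i a) := by
      have e : G * G = (H * U)ᵀ * (H * U) := by
        rw [hG, transpose_mul, hH.eq]
        calc Uᵀ * H * U * (Uᵀ * H * U) = Uᵀ * H * (U * Uᵀ) * H * U := by
              simp only [Matrix.mul_assoc]
          _ = _ := by rw [hU', Matrix.mul_one]; simp only [Matrix.mul_assoc]
      rw [e, mul_apply]
      rfl
    rw [h1, mul_one, ← h2, mul_apply] at h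
    refine le_trans (le_of_eq ?_) h
    exact Finset.sum_congr rfl fun b _ => by rw [hGab a b]; ring
  rw [trace_pow_diagonalized hU hU']
  simp only [hterm]
  have hpair : ∀ i ∈ Finset.range (2 * q + 1),
      ∑ a, ∑ b, G a b ^ 2 * (d a ^ (2 * q - i) * d b ^ i) ≤ K ^ 2 * ∑ a, d a ^ (2 * q) := by
    intro i hi
    have hi' : i ≤ 2 * q := by rw [Finset.mem_range] at hi; omega
    have hswap : ∑ a, ∑ b, G a b ^ 2 * (d a ^ (2 * q - i) * d b ^ i) =
        ∑ a, ∑ b, G a b ^ 2 * (d a ^ i * d b ^ (2 * q - i)) := by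
      rw [Finset.sum_comm]
      refine Finset.sum_congr rfl fun a _ => Finset.sum_congr rfl fun b _ => ?_
      rw [hGab a b]; ring
    have hswap' : ∑ a, ∑ b, G a b ^ 2 * d b ^ (2 * q) = ∑ a, ∑ b, G a b ^ 2 * d a ^ (2 * q) := by
      rw [Finset.sum_comm]
      refine Finset.sum_congr rfl fun a _ => Finset.sum_congr rfl fun b _ => ?_
      rw [hGab a b]
    have hle : ∑ a, ∑ b, G a b ^ 2 * (d a ^ (2 * q - i) * d b ^ i) +
        ∑ a, ∑ b, G a b ^ 2 * (d a ^ i * d b ^ (2 * q - i)) ≤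
        ∑ a, ∑ b, G a b ^ 2 * d a ^ (2 * q) + ∑ a, ∑ b, G a b ^ 2 * d b ^ (2 * q) := by
      simp only [← Finset.sum_add_distrib, ← mul_add]
      refine Finset.sum_le_sum fun a _ => Finset.sum_le_sum fun b _ => ?_
      exact mul_le_mul_of_nonneg_left (pow_mul_pow_add_le _ _ q i hi') (sq_nonneg _)
    have hfin : ∑ a, ∑ b, G a b ^ 2 * d a ^ (2 * q) ≤ K ^ 2 * ∑ a, d a ^ (2 * q) := by
      rw [Finset.mul_sum]
      refine Finset.sum_le_sum fun a _ => ?_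
      rw [← Finset.sum_mul]
      exact mul_le_mul_of_nonneg_right (hrow a) (by rw [pow_mul]; positivity)
    linarith
  refine (Finset.sum_le_sum hpair).trans (le_of_eq ?_)
  rw [Finset.sum_const, Finset.card_range, nsmul_eq_mul]
  push_cast
  ring

section Derivatives

attribute [local instance] Matrix.linftyOpNormedRing Matrix.linftyOpNormedAlgebra

lemma hasDerivAt_trace {F : ℝ → Matrix (Fin n) (Fin n) ℝ} {F' : Matrix (Fin n) (Fin n) ℝ} {t : ℝ}
    (h : HasDerivAt F F' t) : HasDerivAt (fun s => trace (F s)) (trace F') t := by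
  let T : Matrix (Fin n) (Fin n) ℝ →L[ℝ] ℝ := LinearMap.toContinuousLinearMap (traceLinearMap _ ℝ ℝ)
  exact (T.hasFDerivAt.comp_hasDerivAt t h)

lemma hasDerivAt_add_smul (Y H : Matrix (Fin n) (Fin n) ℝ) (t : ℝ) :
    HasDerivAt (fun s : ℝ => Y + s • H) H t := by
  have h := ((hasDerivAt_id t).smul_const H).const_add Y
  rw [one_smul] at h
  exact h

lemma hasDerivAt_trace_pow_mul (Y H : Matrix (Fin n) (Fin n) ℝ) (p : ℕ) (t : ℝ) :
    HasDerivAt (fun s : ℝ => trace ((Y + s • H) ^ p * H))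
      (∑ i ∈ Finset.range p, trace ((Y + t • H) ^ (p - 1 - i) * H * (Y + t • H) ^ i * H)) t := by
  have h := hasDerivAt_trace (((hasDerivAt_add_smul Y H t).fun_pow' p).mul_const H)
  rw [Finset.sum_mul, trace_sum] at h
  exact h

lemma hasDerivAt_trace_pow (Y H : Matrix (Fin n) (Fin n) ℝ) (p : ℕ) (t : ℝ) :
    HasDerivAt (fun s : ℝ => trace ((Y + s • H) ^ p))
      (p * trace ((Y + t • H) ^ (p - 1) * H)) t := by
  have h := hasDerivAt_trace ((hasDerivAt_add_smul Y H t).fun_pow' p)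
  rw [trace_sum] at h
  convert h using 1
  rw [← nsmul_eq_mul, ← Finset.card_range p, ← Finset.sum_const, Finset.card_range]
  refine Finset.sum_congr rfl fun i hi => ?_
  rw [Finset.mem_range] at hi
  rw [trace_mul_comm (_ * H), ← Matrix.mul_assoc, ← pow_add]
  congr 4
  simp only [Nat.pred_eq_sub_one]
  omega

end Derivatives

/-- The truncation of `tr cosh M` at degree `2 Q`. -/
def coshTrace (Q : ℕ) (M : Matrix (Fin n) (Fin n) ℝ) : ℝ :=
  ∑ q ∈ Finset.range (Q + 1), ((2 * q).factorial : ℝ)⁻¹ * trace (M ^ (2 * q))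

/-- The gradient of `coshTrace`. -/
def coshTraceGrad (Q : ℕ) (M : Matrix (Fin n) (Fin n) ℝ) : Matrix (Fin n) (Fin n) ℝ :=
  ∑ q ∈ Finset.range (Q + 1), (((2 * q).factorial : ℝ)⁻¹ * (2 * q : ℕ)) • M ^ (2 * q - 1)

lemma coshTrace_pos [NeZero n] (Q : ℕ) {M : Matrix (Fin n) (Fin n) ℝ} (hM : M.IsSymm) :
    0 < coshTrace Q M := by
  rw [coshTrace, Finset.sum_range_succ']
  refine add_pos_of_nonneg_of_pos (Finset.sum_nonneg fun q _ => ?_) ?_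
  · exact mul_nonneg (by positivity) (trace_pow_even_nonneg hM _)
  · simpa using Nat.pos_of_ne_zero (NeZero.ne n)

lemma hasDerivAt_coshTrace (Q : ℕ) (Y H : Matrix (Fin n) (Fin n) ℝ) (t : ℝ) :
    HasDerivAt (fun s : ℝ => coshTrace Q (Y + s • H))
      (trace (coshTraceGrad Q (Y + t • H) * H)) t := by
  have h := HasDerivAt.fun_sum (u := Finset.range (Q + 1)) fun q _ =>
    (hasDerivAt_trace_pow Y H (2 * q) t).const_mul ((2 * q).factorial : ℝ)⁻¹
  refine h.congr_deriv ?_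
  rw [coshTraceGrad, Finset.sum_mul, trace_sum]
  refine Finset.sum_congr rfl fun q _ => ?_
  rw [smul_mul, trace_smul, smul_eq_mul, mul_assoc]

lemma hasDerivAt_trace_coshTraceGrad (Q : ℕ) (Y H : Matrix (Fin n) (Fin n) ℝ) (t : ℝ) :
    HasDerivAt (fun s : ℝ => trace (coshTraceGrad Q (Y + s • H) * H))
      (∑ q ∈ Finset.range (Q + 1), ((2 * q).factorial : ℝ)⁻¹ * (2 * q : ℕ) *
        ∑ i ∈ Finset.range (2 * q - 1),
          trace ((Y + t • H) ^ (2 * q - 1 - 1 - i) * H * (Y + t • H) ^ i * H)) t := by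
  have h := HasDerivAt.fun_sum (u := Finset.range (Q + 1)) fun q _ =>
    (hasDerivAt_trace_pow_mul Y H (2 * q - 1) t).const_mul
      (((2 * q).factorial : ℝ)⁻¹ * (2 * q : ℕ))
  refine h.congr_of_eventuallyEq (Filter.Eventually.of_forall fun s => ?_)
  simp only [coshTraceGrad]
  rw [Finset.sum_mul, trace_sum]
  refine Finset.sum_congr rfl fun q _ => ?_
  rw [smul_mul, trace_smul, smul_eq_mul]

lemma coshTrace_second_deriv_le (Q : ℕ) {M H : Matrix (Fin n) (Fin n) ℝ} (hM : M.IsSymm)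
    (hH : H.IsSymm) {K : ℝ} (hK : OpBound H K) :
    ∑ q ∈ Finset.range (Q + 1), ((2 * q).factorial : ℝ)⁻¹ * (2 * q : ℕ) *
        ∑ i ∈ Finset.range (2 * q - 1), trace (M ^ (2 * q - 1 - 1 - i) * H * M ^ i * H) ≤
      K ^ 2 * coshTrace Q M := by
  rw [Finset.sum_range_succ', coshTrace, Finset.sum_range_succ, mul_add,
    Finset.mul_sum (Finset.range Q)]
  refine add_le_add (Finset.sum_le_sum fun q _ => ?_) ?_
  · have e1 : 2 * (q + 1) - 1 = 2 * q + 1 := by omega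
    rw [e1, Nat.add_sub_cancel]
    have hfac : ((2 * (q + 1)).factorial : ℝ)⁻¹ * ((2 * (q + 1) : ℕ) : ℝ) * (2 * q + 1) =
        ((2 * q).factorial : ℝ)⁻¹ := by
      have : (2 * (q + 1)).factorial = (2 * (q + 1)) * ((2 * q + 1) * (2 * q).factorial) := by
        rw [show 2 * (q + 1) = 2 * q + 1 + 1 by ring, Nat.factorial_succ, Nat.factorial_succ]
      rw [this]
      push_cast
      have h0 : ((2 * q).factorial : ℝ) ≠ 0 := by positivity
      have h1 : (2 * (q : ℝ) + 1) ≠ 0 := by positivity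
      have h2 : (2 * ((q : ℝ) + 1)) ≠ 0 := by positivity
      field_simp
    calc _ ≤ ((2 * (q + 1)).factorial : ℝ)⁻¹ * ((2 * (q + 1) : ℕ) : ℝ) *
          ((2 * q + 1) * K ^ 2 * trace (M ^ (2 * q))) :=
          mul_le_mul_of_nonneg_left (sum_trace_pow_mul_le hM hH hK q) (by positivity)
      _ = (((2 * (q + 1)).factorial : ℝ)⁻¹ * ((2 * (q + 1) : ℕ) : ℝ) * (2 * q + 1)) *
          (K ^ 2 * trace (M ^ (2 * q))) := by ring
      _ = _ := by rw [hfac]; ring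
  · simp only [mul_zero, Nat.cast_zero, zero_mul]
    exact mul_nonneg (sq_nonneg _) (mul_nonneg (by positivity) (trace_pow_even_nonneg hM _))

/-- A function whose second derivative is at most `c` grows at most quadratically. -/
lemma le_of_second_deriv_le {f f' f'' : ℝ → ℝ} {c : ℝ} (hf : ∀ t, HasDerivAt f (f' t) t)
    (hf' : ∀ t, HasDerivAt f' (f'' t) t) (hc : ∀ t, f'' t ≤ c) : f 1 ≤ f 0 + f' 0 + c / 2 := by
  have h1 : ∀ t, HasDerivAt (fun s => c * s - f' s) (c * 1 - f'' t) t := fun t =>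
    ((hasDerivAt_id t).const_mul c).sub (hf' t)
  have hmono : Monotone (fun s => c * s - f' s) :=
    monotone_of_deriv_nonneg (fun t => (h1 t).differentiableAt) fun t => by
      rw [(h1 t).deriv]; linarith [hc t]
  have h2 : ∀ t, HasDerivAt (fun s => f' 0 * s + c / 2 * s ^ 2 - f s)
      (f' 0 * 1 + c / 2 * (2 * t) - f' t) t := fun t =>
    (((hasDerivAt_id t).const_mul (f' 0)).add
      ((by simpa using hasDerivAt_pow 2 t : HasDerivAt (fun s : ℝ => s ^ 2) (2 * t) t).const_mul
        (c / 2))).sub (hf t)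
  have hmono2 : MonotoneOn (fun s => f' 0 * s + c / 2 * s ^ 2 - f s) (Set.Icc 0 1) := by
    refine monotoneOn_of_deriv_nonneg (convex_Icc 0 1)
      (fun t _ => (h2 t).continuousAt.continuousWithinAt)
      (fun t _ => (h2 t).differentiableAt.differentiableWithinAt) fun t ht => ?_
    rw [interior_Icc] at ht
    rw [(h2 t).deriv]
    have := hmono ht.1.le
    simp only [mul_zero, zero_sub] at this
    linarith
  have := hmono2 (Set.left_mem_Icc.2 zero_le_one) (Set.right_mem_Icc.2 zero_le_one) zero_le_one
  simp only at this
  linarith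

/-- Smoothness of `log tr cosh` with respect to the spectral norm. -/
lemma log_coshTrace_add_le [NeZero n] (Q : ℕ) {Y H : Matrix (Fin n) (Fin n) ℝ} (hY : Y.IsSymm)
    (hH : H.IsSymm) {K : ℝ} (hK : OpBound H K) :
    Real.log (coshTrace Q (Y + H)) ≤ Real.log (coshTrace Q Y) +
      trace (coshTraceGrad Q Y * H) / coshTrace Q Y + K ^ 2 / 2 := by
  have hsym : ∀ t : ℝ, (Y + t • H).IsSymm := fun t => hY.add (hH.smul t)
  have hpos : ∀ t : ℝ, 0 < coshTrace Q (Y + t • H) := fun t => coshTrace_pos Q (hsym t)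
  have h1 := fun t => (hasDerivAt_coshTrace Q Y H t).log (hpos t).ne'
  have h2 := fun t => (hasDerivAt_trace_coshTraceGrad Q Y H t).div (hasDerivAt_coshTrace Q Y H t)
    (hpos t).ne'
  have := le_of_second_deriv_le (c := K ^ 2) h1 h2 fun t => by
    rw [div_le_iff₀ (by have := hpos t; positivity)]
    have ha := coshTrace_second_deriv_le Q (hsym t) hH hK
    have hb := mul_le_mul_of_nonneg_right ha (hpos t).le
    have hc := mul_self_nonneg (trace (coshTraceGrad Q (Y + t • H) * H))
    linarith
  simpa using this

end TracePotential

section FrobeniusInner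

variable {n : ℕ}

lemma finner_add_left (A B X : Matrix (Fin n) (Fin n) ℝ) :
    finner (A + B) X = finner A X + finner B X := by
  simp only [finner, Matrix.add_apply, add_mul, Finset.sum_add_distrib]

lemma finner_smul_left (c : ℝ) (A X : Matrix (Fin n) (Fin n) ℝ) :
    finner (c • A) X = c * finner A X := by
  simp only [finner, Matrix.smul_apply, smul_eq_mul, mul_assoc, Finset.mul_sum]

lemma finner_comm (A X : Matrix (Fin n) (Fin n) ℝ) : finner A X = finner X A := by
  simp only [finner, mul_comm]

lemma finner_neg_left (A X : Matrix (Fin n) (Fin n) ℝ) : finner (-A) X = -finner A X := by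
  rw [← neg_one_smul ℝ, finner_smul_left, neg_one_mul]

lemma finner_add_right (A X Y : Matrix (Fin n) (Fin n) ℝ) :
    finner A (X + Y) = finner A X + finner A Y := by
  rw [finner_comm, finner_add_left, finner_comm X, finner_comm Y]

lemma finner_smul_right (c : ℝ) (A X : Matrix (Fin n) (Fin n) ℝ) :
    finner A (c • X) = c * finner A X := by
  rw [finner_comm, finner_smul_left, finner_comm]

lemma finner_sub_right (A X Y : Matrix (Fin n) (Fin n) ℝ) :
    finner A (X - Y) = finner A X - finner A Y := by
  rw [sub_eq_add_neg, finner_add_right, finner_comm A (-Y), finner_neg_left, finner_comm Y,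
    sub_eq_add_neg]

lemma finner_eq_trace_mul {A : Matrix (Fin n) (Fin n) ℝ} (hA : A.IsSymm)
    (X : Matrix (Fin n) (Fin n) ℝ) : finner A X = trace (X * A) := by
  simp only [finner, trace, diag_apply, mul_apply]
  refine Finset.sum_congr rfl fun i _ => Finset.sum_congr rfl fun j _ => ?_
  rw [hA.apply j i, mul_comm]

end FrobeniusInner

section Covering

variable {n : ℕ}

lemma OpBound.smul {A : Matrix (Fin n) (Fin n) ℝ} {b : ℝ} (h : OpBound A b) (c : ℝ) :
    OpBound (c • A) (c * b) := by
  intro v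
  have := mul_le_mul_of_nonneg_left (h v) (sq_nonneg c)
  rw [smul_mulVec, smul_dotProduct, dotProduct_smul, smul_eq_mul, smul_eq_mul]
  linarith

/-- `log tr cosh` eventually dominates the spectral norm up to an additive constant. -/
lemma eventually_opBound_le_log_coshTrace [NeZero n] {Y : Matrix (Fin n) (Fin n) ℝ}
    (hY : Y.IsSymm) : ∀ᶠ Q in Filter.atTop, ∃ b, 0 ≤ b ∧ OpBound Y b ∧
      b ≤ Real.log (coshTrace Q Y) + Real.log 4 := by
  have hsymm := hY
  obtain ⟨U, d, hU, hU', rfl⟩ := exists_orthogonal_diagonalization hY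
  obtain ⟨a₀, -, ha₀⟩ := Finset.exists_max_image Finset.univ (fun a => |d a|)
    ⟨(0 : Fin n), Finset.mem_univ _⟩
  have hop : OpBound (U * diagonal d * Uᵀ) |d a₀| := by
    intro v
    have hiso : ∀ w : Fin n → ℝ, (U *ᵥ w) ⬝ᵥ (U *ᵥ w) = w ⬝ᵥ w := fun w => by
      rw [dotProduct_mulVec, vecMul_mulVec, hU, vecMul_one]
    have hiso' : ∀ w : Fin n → ℝ, (Uᵀ *ᵥ w) ⬝ᵥ (Uᵀ *ᵥ w) = w ⬝ᵥ w := fun w => by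
      rw [dotProduct_mulVec, vecMul_mulVec, transpose_transpose, hU', vecMul_one]
    rw [← mulVec_mulVec, ← mulVec_mulVec, hiso, ← hiso' v]
    set w := Uᵀ *ᵥ v
    simp only [dotProduct, mulVec_diagonal, Finset.mul_sum]
    refine Finset.sum_le_sum fun a _ => ?_
    have h1 : d a ^ 2 ≤ |d a₀| ^ 2 := by
      rw [← sq_abs]
      exact pow_le_pow_left₀ (abs_nonneg _) (ha₀ a (Finset.mem_univ a)) 2
    nlinarith [mul_le_mul_of_nonneg_right h1 (mul_self_nonneg (w a))]
  have hlim := (Real.hasSum_cosh (d a₀)).tendsto_sum_nat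
  have hlt : Real.exp |d a₀| / 4 < Real.cosh (d a₀) := by
    rw [← Real.cosh_abs, Real.cosh_eq]
    have := Real.exp_pos |d a₀|
    have := Real.exp_pos (-|d a₀|)
    linarith
  have hev := (Filter.tendsto_add_atTop_iff_nat 1).2 hlim |>.eventually (lt_mem_nhds hlt)
  filter_upwards [hev] with Q hQ
  refine ⟨|d a₀|, abs_nonneg _, hop, ?_⟩
  rw [← Real.log_mul (coshTrace_pos Q hsymm).ne' (by norm_num)]
  rw [Real.le_log_iff_exp_le (mul_pos (coshTrace_pos Q hsymm) (by norm_num))]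
  have hle : ∑ q ∈ Finset.range (Q + 1), d a₀ ^ (2 * q) / ((2 * q).factorial : ℝ) ≤
      coshTrace Q (U * diagonal d * Uᵀ) := by
    refine Finset.sum_le_sum fun q _ => ?_
    rw [trace_pow_diagonalized hU hU', div_eq_inv_mul]
    refine mul_le_mul_of_nonneg_left ?_ (by positivity)
    exact Finset.single_le_sum (f := fun a => d a ^ (2 * q))
      (fun a _ => by rw [pow_mul]; positivity) (Finset.mem_univ a₀)
  linarith

open Classical in
/-- All matrices obtained from `0` by adding `t` multiples `η • A` with `A ∈ O`. -/
def mirrorStates (O : Finset (Matrix (Fin n) (Fin n) ℝ)) (η : ℝ) :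
    ℕ → Finset (Matrix (Fin n) (Fin n) ℝ)
  | 0 => {0}
  | t + 1 => (mirrorStates O η t ×ˢ O).image fun p => p.1 + η • p.2

lemma mirrorStates_card_le (O : Finset (Matrix (Fin n) (Fin n) ℝ)) (η : ℝ) (t : ℕ) :
    (mirrorStates O η t).card ≤ O.card ^ t := by
  induction t with
  | zero => simp [mirrorStates]
  | succ t ih =>
    rw [mirrorStates, pow_succ]
    refine Finset.card_image_le.trans ?_
    rw [Finset.card_product]
    exact Nat.mul_le_mul_right _ ih

lemma add_smul_mem_mirrorStates {O : Finset (Matrix (Fin n) (Fin n) ℝ)} {η : ℝ} {t : ℕ}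
    {Y A : Matrix (Fin n) (Fin n) ℝ} (hY : Y ∈ mirrorStates O η t) (hA : A ∈ O) :
    Y + η • A ∈ mirrorStates O η (t + 1) := by
  rw [mirrorStates, Finset.mem_image]
  exact ⟨(Y, A), Finset.mem_product.2 ⟨hY, hA⟩, rfl⟩

lemma mirrorStates_mono {O : Finset (Matrix (Fin n) (Fin n) ℝ)} (h0 : 0 ∈ O) (η : ℝ) :
    Monotone (mirrorStates O η) :=
  monotone_nat_of_le_succ fun t Y hY => by simpa using add_smul_mem_mirrorStates hY h0

lemma mirrorStates_isSymm {O : Finset (Matrix (Fin n) (Fin n) ℝ)} (hO : ∀ A ∈ O, A.IsSymm)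
    (η : ℝ) (t : ℕ) : ∀ Y ∈ mirrorStates O η t, Y.IsSymm := by
  induction t with
  | zero =>
    intro Y hY
    rw [mirrorStates, Finset.mem_singleton] at hY
    rw [hY]; exact isSymm_zero
  | succ t ih =>
    intro Y hY
    rw [mirrorStates, Finset.mem_image] at hY
    obtain ⟨p, hp, rfl⟩ := hY
    rw [Finset.mem_product] at hp
    exact (ih _ hp.1).add ((hO _ hp.2).smul η)

open Classical in
/-- Covering of a nuclear-norm ball (described by duality) in the seminorm `max_{A ∈ O} ⟨A, ·⟩`,
by running mirror descent with the potential `log tr cosh`. -/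
lemma exists_cover [NeZero n] {O : Finset (Matrix (Fin n) (Fin n) ℝ)}
    (hsym : ∀ A ∈ O, A.IsSymm) (h0 : 0 ∈ O) {K R ε : ℝ} (hK : 0 < K) (hR : 0 < R) (hε : 0 < ε)
    (hop : ∀ A ∈ O, OpBound A K) {T : ℕ}
    (hT : R * Real.log (4 * n) < T * (ε ^ 2 / (2 * K ^ 2 * R))) :
    ∃ C : Finset (Matrix (Fin n) (Fin n) ℝ), C.card ≤ O.card ^ T ∧
      ∀ X : Matrix (Fin n) (Fin n) ℝ,
        (∀ Y : Matrix (Fin n) (Fin n) ℝ, Y.IsSymm → ∀ b, 0 ≤ b → OpBound Y b →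
          finner Y X ≤ R * b) →
        ∃ c ∈ C, ∀ A ∈ O, finner A X - finner A c ≤ ε := by
  set η : ℝ := ε / (K ^ 2 * R) with hη
  have hss := mirrorStates_isSymm hsym η
  obtain ⟨Q, hQ⟩ := ((Filter.eventually_all_finset (mirrorStates O η T)).2
    fun Y hY => eventually_opBound_le_log_coshTrace (hss T Y hY)).exists
  let cen : Matrix (Fin n) (Fin n) ℝ → Matrix (Fin n) (Fin n) ℝ := fun Y =>
    (R / coshTrace Q Y) • coshTraceGrad Q Y
  refine ⟨(mirrorStates O η T).image cen,
    Finset.card_image_le.trans (mirrorStates_card_le O η T), fun X hX => ?_⟩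
  by_contra hcon
  push Not at hcon
  have hbad : ∀ Y ∈ mirrorStates O η T, ∃ A ∈ O, ε < finner A X - finner A (cen Y) :=
    fun Y hY => hcon _ (Finset.mem_image_of_mem _ hY)
  have hdesc : ∀ t ≤ T, ∃ Y ∈ mirrorStates O η t,
      R * Real.log (coshTrace Q Y) - finner Y X ≤
        R * Real.log n - t * (ε ^ 2 / (2 * K ^ 2 * R)) := by
    intro t
    induction t with
    | zero =>
      intro _
      refine ⟨0, by simp [mirrorStates], ?_⟩
      have e1 : coshTrace Q (0 : Matrix (Fin n) (Fin n) ℝ) = n := by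
        rw [coshTrace, Finset.sum_range_succ']
        simp
      have e2 : finner 0 X = 0 := by simp [finner]
      rw [e1, e2]
      simp
    | succ t ih =>
      intro ht
      obtain ⟨Y, hY, hle⟩ := ih (by omega)
      obtain ⟨A, hA, hAε⟩ := hbad Y (mirrorStates_mono h0 η (by omega : t ≤ T) hY)
      refine ⟨Y + η • A, add_smul_mem_mirrorStates hY hA, ?_⟩
      have hYs := hss t Y hY
      have hstep := log_coshTrace_add_le Q hYs ((hsym A hA).smul η) ((hop A hA).smul η)
      have hcen : R * (trace (coshTraceGrad Q Y * (η • A)) / coshTrace Q Y) =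
          η * finner A (cen Y) := by
        rw [finner_smul_right, finner_eq_trace_mul (hsym A hA), Matrix.mul_smul, trace_smul,
          smul_eq_mul]
        ring
      have hstep' := mul_le_mul_of_nonneg_left hstep hR.le
      rw [mul_add, mul_add, hcen] at hstep'
      rw [finner_add_left, finner_smul_left]
      have hηpos : 0 < η := by positivity
      have hgain := mul_lt_mul_of_pos_left hAε hηpos
      have hnum : R * ((η * K) ^ 2 / 2) - η * ε = -(ε ^ 2 / (2 * K ^ 2 * R)) := by
        rw [hη]; field_simp; ring
      push_cast
      linarith
  obtain ⟨Y, hY, hle⟩ := hdesc T le_rfl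
  obtain ⟨b, hb0, hb, hblog⟩ := hQ Y hY
  have h1 := hX Y (hss T Y hY) b hb0 hb
  have h2 := mul_le_mul_of_nonneg_left hblog hR.le
  have hn : (0 : ℝ) < n := by exact_mod_cast Nat.pos_of_ne_zero (NeZero.ne n)
  rw [Real.log_mul (by norm_num) hn.ne'] at hT
  linarith

open Classical in
/-- The covering of `exists_cover` with centers in the covered set. -/
lemma exists_net [NeZero n] {O : Finset (Matrix (Fin n) (Fin n) ℝ)}
    (hsym : ∀ A ∈ O, A.IsSymm) (h0 : 0 ∈ O) (hneg : ∀ A ∈ O, -A ∈ O) {K R ε : ℝ} (hK : 0 < K)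
    (hR : 0 < R) (hε : 0 < ε) (hop : ∀ A ∈ O, OpBound A K) {T : ℕ}
    (hT : R * Real.log (4 * n) < T * (ε ^ 2 / (2 * K ^ 2 * R)))
    {D : Set (Matrix (Fin n) (Fin n) ℝ)} (hD0 : 0 ∈ D)
    (hD : ∀ X ∈ D, ∀ Y : Matrix (Fin n) (Fin n) ℝ, Y.IsSymm → ∀ b, 0 ≤ b → OpBound Y b →
      finner Y X ≤ R * b) :
    ∃ F : Finset (Matrix (Fin n) (Fin n) ℝ), F.card ≤ O.card ^ T ∧ (∀ Y ∈ F, Y ∈ D) ∧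
      ∀ X ∈ D, ∃ Y ∈ F, ∀ A ∈ O, |finner A (X - Y)| ≤ 2 * ε := by
  obtain ⟨C, hCcard, hC⟩ := exists_cover hsym h0 hK hR hε hop hT
  have habs : ∀ X c : Matrix (Fin n) (Fin n) ℝ, (∀ A ∈ O, finner A X - finner A c ≤ ε) →
      ∀ A ∈ O, |finner A X - finner A c| ≤ ε := by
    intro X c h A hA
    rw [abs_le]
    have := h _ (hneg A hA)
    rw [finner_neg_left, finner_neg_left] at this
    exact ⟨by linarith, h A hA⟩
  have hrep : ∀ c, ∃ Z ∈ D, (∃ X ∈ D, ∀ A ∈ O, finner A X - finner A c ≤ ε) →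
      ∀ A ∈ O, finner A Z - finner A c ≤ ε := by
    intro c
    by_cases h : ∃ X ∈ D, ∀ A ∈ O, finner A X - finner A c ≤ ε
    · obtain ⟨X, hX, hXc⟩ := h
      exact ⟨X, hX, fun _ => hXc⟩
    · exact ⟨0, hD0, fun h' => absurd h' h⟩
  choose rep hrepD hrep using hrep
  refine ⟨C.image rep, Finset.card_image_le.trans hCcard, ?_, fun X hX => ?_⟩
  · intro Y hY
    obtain ⟨c, -, rfl⟩ := Finset.mem_image.1 hY
    exact hrepD c
  · obtain ⟨c, hc, hXc⟩ := hC X (hD X hX)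
    refine ⟨rep c, Finset.mem_image_of_mem _ hc, fun A hA => ?_⟩
    have h1 := abs_le.1 (habs _ _ hXc A hA)
    have h2 := abs_le.1 (habs _ _ (hrep c ⟨X, hX, hXc⟩) A hA)
    rw [finner_sub_right, abs_le]
    constructor <;> linarith [h1.1, h1.2, h2.1, h2.2]

end Covering

section MomentReduction

/-- A sum of finitely many vectors is a nonnegative combination of at most `dim + 1` of them. -/
lemma exists_sparse_sum {V : Type} [AddCommGroup V] [Module ℝ V] [FiniteDimensional ℝ V] {m : ℕ}
    (hm : 0 < m) (x : Fin m → V) :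
    ∃ (ι : Type) (_ : Fintype ι) (k : ι → Fin m) (w : ι → ℝ),
      Fintype.card ι ≤ Module.finrank ℝ V + 1 ∧ (∀ j, 0 ≤ w j) ∧
        ∑ j, w j • x (k j) = ∑ i, x i := by
  have hm' : (0 : ℝ) < m := by exact_mod_cast hm
  have hmem : ∑ i, (m : ℝ)⁻¹ • x i ∈ convexHull ℝ (Set.range x) := by
    refine (convex_convexHull ℝ _).sum_mem (fun i _ => by positivity) ?_
      (fun i _ => subset_convexHull ℝ _ ⟨i, rfl⟩)
    simp [hm'.ne']
  obtain ⟨ι, hι, z, w, hz, haff, hw, -, hsum⟩ := eq_pos_convex_span_of_mem_convexHull hmem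
  choose k hk using fun j => hz ⟨j, rfl⟩
  refine ⟨ι, hι, k, fun j => m * w j, ?_, fun j => mul_nonneg hm'.le (hw j).le, ?_⟩
  · refine haff.card_le_finrank_succ.trans ?_
    exact Nat.add_le_add_right (Submodule.finrank_le _) 1
  · simp only [hk, mul_smul, ← Finset.smul_sum, hsum]
    exact smul_inv_smul₀ hm'.ne' _

variable {n : ℕ}

lemma finner_eq_sum_prod (A X : Matrix (Fin n) (Fin n) ℝ) :
    finner A X = ∑ p : Fin n × Fin n, A p.1 p.2 * X p.1 p.2 := by
  rw [finner, Fintype.sum_prod_type]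

/-- The second and fourth moments of a family of matrices agree with those of a weighted
subfamily of size polynomial in the dimension. -/
lemma exists_moment_reduction {m : ℕ} (hm : 0 < m) (B : Fin m → Matrix (Fin n) (Fin n) ℝ) :
    ∃ (ι : Type) (_ : Fintype ι) (k : ι → Fin m) (w : ι → ℝ),
      Fintype.card ι ≤ n ^ 8 + n ^ 4 + 1 ∧ (∀ j, 0 ≤ w j) ∧
        (∀ X, ∑ j, w j * finner (B (k j)) X ^ 2 = ∑ i, finner (B i) X ^ 2) ∧
        ∀ X Y, ∑ j, w j * (finner (B (k j)) X ^ 2 * finner (B (k j)) Y ^ 2) =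
          ∑ i, finner (B i) X ^ 2 * finner (B i) Y ^ 2 := by
  let p := Fin n × Fin n
  let V := (p × p × p × p → ℝ) × (p × p → ℝ)
  let e : Matrix (Fin n) (Fin n) ℝ → p → ℝ := fun A z => A z.1 z.2
  let φ : Matrix (Fin n) (Fin n) ℝ → V := fun A =>
    (fun z => e A z.1 * e A z.2.1 * (e A z.2.2.1 * e A z.2.2.2), fun z => e A z.1 * e A z.2)
  obtain ⟨ι, hι, k, w, hcard, hw, hsum⟩ := exists_sparse_sum hm fun i => φ (B i)
  refine ⟨ι, hι, k, w, hcard.trans (le_of_eq ?_), hw, fun X => ?_, fun X Y => ?_⟩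
  · simp only [V, p, Module.finrank_prod, Module.finrank_fintype_fun_eq_card, Fintype.card_prod,
      Fintype.card_fin]
    ring
  · have h2 := congrArg Prod.snd hsum
    rw [Prod.snd_sum, Prod.snd_sum] at h2
    have hform : ∀ A : Matrix (Fin n) (Fin n) ℝ,
        finner A X ^ 2 = ∑ z : p × p, (φ A).2 z * (e X z.1 * e X z.2) := by
      intro A
      rw [finner_eq_sum_prod, sq, Finset.sum_mul_sum]
      simp only [Fintype.sum_prod_type (α₁ := p)]
      refine Finset.sum_congr rfl fun a _ => ?_
      refine Finset.sum_congr rfl fun b _ => ?_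
      simp only [φ, e]; ring
    simp only [hform, Finset.mul_sum]
    rw [Finset.sum_comm, Finset.sum_comm (s := (Finset.univ : Finset (Fin m)))]
    refine Finset.sum_congr rfl fun z _ => ?_
    have := congrFun h2 z
    simp only [Finset.sum_apply] at this
    rw [← Finset.sum_mul, ← this, Finset.sum_mul]
    refine Finset.sum_congr rfl fun j _ => ?_
    have hs : (w j • φ (B (k j))).2 z = w j * (φ (B (k j))).2 z := rfl
    rw [hs]; ring
  · have h4 := congrArg Prod.fst hsum
    rw [Prod.fst_sum, Prod.fst_sum] at h4
    have hform : ∀ A : Matrix (Fin n) (Fin n) ℝ,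
        finner A X ^ 2 * finner A Y ^ 2 = ∑ z : p × p × p × p,
          (φ A).1 z * (e X z.1 * e X z.2.1 * (e Y z.2.2.1 * e Y z.2.2.2)) := by
      intro A
      rw [finner_eq_sum_prod, finner_eq_sum_prod, sq, sq, Finset.sum_mul_sum, Finset.sum_mul_sum]
      simp only [Fintype.sum_prod_type (α₁ := p)]
      rw [Finset.sum_mul]
      refine Finset.sum_congr rfl fun a _ => ?_
      rw [Finset.sum_mul]
      refine Finset.sum_congr rfl fun b _ => ?_
      rw [Finset.mul_sum]
      refine Finset.sum_congr rfl fun c _ => ?_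
      rw [Finset.mul_sum]
      refine Finset.sum_congr rfl fun d _ => ?_
      simp only [φ, e]; ring
    simp only [hform, Finset.mul_sum]
    rw [Finset.sum_comm, Finset.sum_comm (s := (Finset.univ : Finset (Fin m)))]
    refine Finset.sum_congr rfl fun z _ => ?_
    have := congrFun h4 z
    simp only [Finset.sum_apply] at this
    rw [← Finset.sum_mul, ← this, Finset.sum_mul]
    refine Finset.sum_congr rfl fun j _ => ?_
    have hs : (w j • φ (B (k j))).1 z = w j * (φ (B (k j))).1 z := rfl
    rw [hs]; ring

end MomentReduction

section Chaining

variable {n : ℕ}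

/-- The symmetrized matrix unit at the entry `(a, b)`. -/
def symmUnit (a b : Fin n) : Matrix (Fin n) (Fin n) ℝ :=
  (1 / 2 : ℝ) • (single a b 1 + single b a 1)

lemma symmUnit_isSymm (a b : Fin n) : (symmUnit a b).IsSymm := by
  rw [Matrix.IsSymm, symmUnit, transpose_smul, transpose_add, transpose_single, transpose_single,
    add_comm]

lemma finner_single (a b : Fin n) (X : Matrix (Fin n) (Fin n) ℝ) :
    finner (single a b 1) X = X a b := by
  rw [finner, Finset.sum_eq_single a, Finset.sum_eq_single b]
  · simp
  · intro c _ hc; simp [hc.symm]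
  · simp
  · intro c _ hc; simp [hc.symm]
  · simp

lemma finner_symmUnit (a b : Fin n) {X : Matrix (Fin n) (Fin n) ℝ} (hX : X.IsSymm) :
    finner (symmUnit a b) X = X a b := by
  rw [symmUnit, finner_smul_left, finner_add_left, finner_single, finner_single, hX.apply a b]
  ring

lemma opBound_symmUnit (a b : Fin n) : OpBound (symmUnit a b) 1 := by
  intro v
  have hcoord : ∀ c, v c ^ 2 ≤ v ⬝ᵥ v := fun c => by
    rw [dotProduct, sq]
    exact Finset.single_le_sum (f := fun i => v i * v i) (fun i _ => mul_self_nonneg _)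
      (Finset.mem_univ c)
  have hmul : symmUnit a b *ᵥ v = (1 / 2 : ℝ) • (Pi.single a (v b) + Pi.single b (v a)) := by
    rw [symmUnit, smul_mulVec, add_mulVec, single_mulVec, single_mulVec]
    simp [Pi.single]
  rw [hmul, smul_dotProduct, dotProduct_smul, add_dotProduct, dotProduct_add, dotProduct_add,
    single_dotProduct, single_dotProduct, single_dotProduct, single_dotProduct]
  have ha := hcoord a
  have hb := hcoord b
  by_cases hab : a = b
  · subst hab
    simp only [Pi.single_eq_same, smul_eq_mul]
    nlinarith
  · simp only [Pi.single_eq_same, Pi.single_eq_of_ne hab, Pi.single_eq_of_ne (Ne.symm hab),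
      smul_eq_mul]
    nlinarith

lemma OpBound.neg {A : Matrix (Fin n) (Fin n) ℝ} {b : ℝ} (h : OpBound A b) : OpBound (-A) b := by
  intro v
  simpa [neg_mulVec] using h v

lemma OpBound.entry_sq_le {A : Matrix (Fin n) (Fin n) ℝ} {b : ℝ} (h : OpBound A b)
    (i j : Fin n) : A i j ^ 2 ≤ b ^ 2 := by
  have := h (Pi.single j 1)
  rw [mulVec_single_one, single_dotProduct, Pi.single_eq_same, mul_one, mul_one] at this
  refine le_trans ?_ this
  rw [sq]
  exact Finset.single_le_sum (f := fun i => A i j * A i j) (fun i _ => mul_self_nonneg _)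
    (Finset.mem_univ i)

open Classical in
/-- A symmetric set of test matrices containing a given family and detecting all entries. -/
lemma exists_test_set (hn : 2 ≤ n) {K : ℝ} (hK : 0 < K) {ι : Type} [Fintype ι]
    (B : ι → Matrix (Fin n) (Fin n) ℝ) (hB : ∀ j, (B j).IsSymm) (hop : ∀ j, OpBound (B j) K)
    (hcard : Fintype.card ι ≤ n ^ 8 + n ^ 4 + 1) :
    ∃ O : Finset (Matrix (Fin n) (Fin n) ℝ), O.card ≤ n ^ 10 ∧ (∀ A ∈ O, A.IsSymm) ∧ 0 ∈ O ∧
      (∀ A ∈ O, -A ∈ O) ∧ (∀ A ∈ O, OpBound A K) ∧ (∀ j, B j ∈ O) ∧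
      ∀ a b, K • symmUnit a b ∈ O := by
  let O₁ : Finset (Matrix (Fin n) (Fin n) ℝ) := insert 0 (Finset.univ.image B ∪
    (Finset.univ : Finset (Fin n × Fin n)).image fun p => K • symmUnit p.1 p.2)
  have hO₁ : ∀ A ∈ O₁, A.IsSymm ∧ OpBound A K := by
    intro A hA
    simp only [O₁, Finset.mem_insert, Finset.mem_union, Finset.mem_image, Finset.mem_univ,
      true_and] at hA
    rcases hA with rfl | ⟨j, rfl⟩ | ⟨p, rfl⟩
    · refine ⟨isSymm_zero, fun v => ?_⟩
      have : 0 ≤ v ⬝ᵥ v := Finset.sum_nonneg fun i _ => mul_self_nonneg _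
      simp only [zero_mulVec, zero_dotProduct]
      positivity
    · exact ⟨hB j, hop j⟩
    · exact ⟨(symmUnit_isSymm _ _).smul _, by simpa using (opBound_symmUnit p.1 p.2).smul K⟩
  have hcard₁ : O₁.card ≤ n ^ 8 + n ^ 4 + 1 + n ^ 2 + 1 := by
    refine (Finset.card_insert_le _ _).trans (Nat.add_le_add_right ?_ 1)
    refine (Finset.card_union_le _ _).trans (Nat.add_le_add ?_ ?_)
    · exact Finset.card_image_le.trans hcard
    · refine Finset.card_image_le.trans (le_of_eq ?_)
      simp [sq]
  refine ⟨O₁ ∪ O₁.image Neg.neg, ?_, ?_, ?_, ?_, ?_, ?_, ?_⟩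
  · refine (Finset.card_union_le _ _).trans ?_
    have h1 : (O₁.image Neg.neg).card ≤ O₁.card := Finset.card_image_le
    have h2 : 4 ≤ n ^ 2 := by nlinarith
    have h4 : n ^ 4 = n ^ 2 * n ^ 2 := by ring
    have h8 : n ^ 8 = n ^ 4 * n ^ 4 := by ring
    have h10 : n ^ 10 = n ^ 8 * n ^ 2 := by ring
    have : n ^ 2 * 4 ≤ n ^ 4 := by rw [h4]; exact Nat.mul_le_mul_left _ h2
    have : n ^ 4 * 4 ≤ n ^ 8 := by rw [h8]; exact Nat.mul_le_mul_left _ (by omega)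
    have : n ^ 8 * 4 ≤ n ^ 10 := by rw [h10]; exact Nat.mul_le_mul_left _ h2
    omega
  · intro A hA
    rcases Finset.mem_union.1 hA with h | h
    · exact (hO₁ A h).1
    · obtain ⟨A', h', rfl⟩ := Finset.mem_image.1 h
      exact (hO₁ A' h').1.neg
  · exact Finset.mem_union_left _ (Finset.mem_insert_self _ _)
  · intro A hA
    rcases Finset.mem_union.1 hA with h | h
    · exact Finset.mem_union_right _ (Finset.mem_image_of_mem _ h)
    · obtain ⟨A', h', rfl⟩ := Finset.mem_image.1 h
      rw [neg_neg]
      exact Finset.mem_union_left _ h'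
  · intro A hA
    rcases Finset.mem_union.1 hA with h | h
    · exact (hO₁ A h).2
    · obtain ⟨A', h', rfl⟩ := Finset.mem_image.1 h
      exact (hO₁ A' h').2.neg
  · exact fun j => Finset.mem_union_left _ (Finset.mem_insert_of_mem
      (Finset.mem_union_left _ (Finset.mem_image_of_mem _ (Finset.mem_univ j))))
  · exact fun a b => Finset.mem_union_left _ (Finset.mem_insert_of_mem
      (Finset.mem_union_right _ (Finset.mem_image.2 ⟨(a, b), Finset.mem_univ _, rfl⟩)))

lemma log_natCast_gt {n : ℕ} (hn : 2 ≤ n) : 0.69 < Real.log n := by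
  have h1 := Real.log_two_gt_d9
  have h2 : Real.log 2 ≤ Real.log n :=
    Real.log_le_log (by norm_num) (by exact_mod_cast hn)
  linarith

/-- Nets at the dyadic scales `2 ^ (-j)`, the coarsest one being `{0}`. -/
lemma exists_dyadic_net (hn : 2 ≤ n) {O : Finset (Matrix (Fin n) (Fin n) ℝ)}
    (hcard : O.card ≤ n ^ 10)
    (hsym : ∀ A ∈ O, A.IsSymm) (h0 : 0 ∈ O) (hneg : ∀ A ∈ O, -A ∈ O) {K R : ℝ} (hK : 0 < K)
    (hR : 0 < R) (hop : ∀ A ∈ O, OpBound A K)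
    {D : Set (Matrix (Fin n) (Fin n) ℝ)} (hD0 : 0 ∈ D)
    (hD : ∀ X ∈ D, ∀ Y : Matrix (Fin n) (Fin n) ℝ, Y.IsSymm → ∀ b, 0 ≤ b → OpBound Y b →
      finner Y X ≤ R * b) (j : ℕ) :
    ∃ F : Finset (Matrix (Fin n) (Fin n) ℝ), (j = 0 → F = {0}) ∧
      Real.log F.card ≤ 80 * 4 ^ j * Real.log n ^ 2 ∧ (∀ Y ∈ F, Y ∈ D) ∧
      ∀ X ∈ D, ∃ Y ∈ F, ∀ A ∈ O, |finner A (X - Y)| ≤ 2 * (K * R / 2 ^ j) := by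
  have hlog := log_natCast_gt hn
  rcases Nat.eq_zero_or_pos j with rfl | hj
  · refine ⟨{0}, fun _ => rfl, ?_, ?_, fun X hX => ⟨0, by simp, fun A hA => ?_⟩⟩
    · simp only [Finset.card_singleton, Nat.cast_one, Real.log_one]; positivity
    · intro Y hY; rw [Finset.mem_singleton.1 hY]; exact hD0
    · have h1 := hD X hX A (hsym A hA) K hK.le (hop A hA)
      have h2 := hD X hX (-A) (hsym A hA).neg K hK.le (hop A hA).neg
      rw [finner_neg_left] at h2
      have : 0 < R * K := by positivity
      rw [sub_zero, abs_le]
      constructor <;> simp only [pow_zero, div_one] <;> linarith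
  have : NeZero n := ⟨by omega⟩
  set T : ℕ := ⌊6 * 4 ^ j * Real.log n⌋₊ + 1 with hTdef
  have hnpos : (0 : ℝ) < n := by exact_mod_cast (by omega : 0 < n)
  have h4 : (1 : ℝ) ≤ 4 ^ j := one_le_pow₀ (by norm_num)
  have hTlow : 6 * 4 ^ j * Real.log n < T := by
    rw [hTdef]; push_cast; exact Nat.lt_floor_add_one _
  have hThigh : (T : ℝ) ≤ 8 * 4 ^ j * Real.log n := by
    have : (⌊6 * 4 ^ j * Real.log n⌋₊ : ℝ) ≤ 6 * 4 ^ j * Real.log n :=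
      Nat.floor_le (by positivity)
    rw [hTdef]; push_cast
    nlinarith
  have hlog4 : Real.log (4 * n) ≤ 3 * Real.log n := by
    have : Real.log (4 * n) ≤ Real.log ((n : ℝ) ^ 3) := by
      refine Real.log_le_log (by positivity) ?_
      have : (2 : ℝ) ≤ n := by exact_mod_cast hn
      nlinarith [mul_self_nonneg ((n : ℝ) - 2)]
    rwa [Real.log_pow] at this
  have hT : R * Real.log (4 * n) < T * ((K * R / 2 ^ j) ^ 2 / (2 * K ^ 2 * R)) := by
    have e : (K * R / 2 ^ j) ^ 2 / (2 * K ^ 2 * R) = R / (2 * 4 ^ j) := by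
      have : (4 : ℝ) ^ j = 2 ^ j * 2 ^ j := by rw [← mul_pow]; norm_num
      rw [this]; field_simp
    rw [e, mul_div_assoc', lt_div_iff₀ (by positivity)]
    have : 2 * 4 ^ j * Real.log (4 * n) < T := by nlinarith
    nlinarith
  obtain ⟨F, hFcard, hFD, hF⟩ := exists_net hsym h0 hneg hK hR
    (by positivity : 0 < K * R / 2 ^ j) hop hT hD0 hD
  refine ⟨F, fun h => absurd h hj.ne', ?_, hFD, hF⟩
  obtain ⟨Y, hY, -⟩ := hF 0 hD0
  have hFpos : (0 : ℝ) < F.card := by exact_mod_cast Finset.card_pos.2 ⟨Y, hY⟩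
  have hle : (F.card : ℝ) ≤ ((n : ℝ) ^ 10) ^ T := by
    exact_mod_cast hFcard.trans (Nat.pow_le_pow_left hcard T)
  calc Real.log F.card ≤ Real.log (((n : ℝ) ^ 10) ^ T) := Real.log_le_log hFpos hle
    _ = T * (10 * Real.log n) := by rw [Real.log_pow, Real.log_pow]; norm_num
    _ ≤ (8 * 4 ^ j * Real.log n) * (10 * Real.log n) := by gcongr
    _ = 80 * 4 ^ j * Real.log n ^ 2 := by ring

end Chaining

section GaussianChaining

variable {n m : ℕ}

/-- The quadratic process `X ↦ ∑ i, t i * ⟨B i, X⟩ ^ 2`. -/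
def quadForm (B : Fin m → Matrix (Fin n) (Fin n) ℝ) (t : Fin m → ℝ)
    (X : Matrix (Fin n) (Fin n) ℝ) : ℝ :=
  ∑ i, t i * finner (B i) X ^ 2

lemma quadForm_sub (B : Fin m → Matrix (Fin n) (Fin n) ℝ) (t : Fin m → ℝ)
    (X Y : Matrix (Fin n) (Fin n) ℝ) :
    quadForm B t X - quadForm B t Y = ∑ i, t i * (finner (B i) X ^ 2 - finner (B i) Y ^ 2) := by
  simp only [quadForm, mul_sub, Finset.sum_sub_distrib]

lemma increment_variance_le {B : Fin m → Matrix (Fin n) (Fin n) ℝ} {ι : Type} [Fintype ι]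
    {k : ι → Fin m} {w : ι → ℝ} (hw : ∀ j, 0 ≤ w j)
    (h2 : ∀ X, ∑ j, w j * finner (B (k j)) X ^ 2 = ∑ i, finner (B i) X ^ 2)
    (h4 : ∀ X Y, ∑ j, w j * (finner (B (k j)) X ^ 2 * finner (B (k j)) Y ^ 2) =
      ∑ i, finner (B i) X ^ 2 * finner (B i) Y ^ 2)
    {S e : ℝ} {X Y : Matrix (Fin n) (Fin n) ℝ} (hX : ∑ i, finner (B i) X ^ 2 ≤ S ^ 2)
    (hY : ∑ i, finner (B i) Y ^ 2 ≤ S ^ 2) (he : ∀ j, |finner (B (k j)) (X - Y)| ≤ e) :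
    ∑ i, (finner (B i) X ^ 2 - finner (B i) Y ^ 2) ^ 2 ≤ (2 * e * S) ^ 2 := by
  have hsum : ∑ i, finner (B i) (X + Y) ^ 2 ≤ 4 * S ^ 2 := by
    calc ∑ i, finner (B i) (X + Y) ^ 2
        ≤ ∑ i, (2 * finner (B i) X ^ 2 + 2 * finner (B i) Y ^ 2) := by
          refine Finset.sum_le_sum fun i _ => ?_
          rw [finner_add_right]
          nlinarith [sq_nonneg (finner (B i) X - finner (B i) Y)]
      _ ≤ 4 * S ^ 2 := by
          rw [Finset.sum_add_distrib, ← Finset.mul_sum, ← Finset.mul_sum]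
          linarith
  calc ∑ i, (finner (B i) X ^ 2 - finner (B i) Y ^ 2) ^ 2
      = ∑ i, finner (B i) (X - Y) ^ 2 * finner (B i) (X + Y) ^ 2 := by
        refine Finset.sum_congr rfl fun i _ => ?_
        rw [finner_sub_right, finner_add_right]
        ring
    _ = ∑ j, w j * (finner (B (k j)) (X - Y) ^ 2 * finner (B (k j)) (X + Y) ^ 2) := (h4 _ _).symm
    _ ≤ ∑ j, e ^ 2 * (w j * finner (B (k j)) (X + Y) ^ 2) := by
        refine Finset.sum_le_sum fun j _ => ?_
        have h1 : finner (B (k j)) (X - Y) ^ 2 ≤ e ^ 2 := by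
          rw [← sq_abs]
          exact pow_le_pow_left₀ (abs_nonneg _) (he j) 2
        have h3 := mul_le_mul_of_nonneg_right h1
          (mul_nonneg (hw j) (sq_nonneg (finner (B (k j)) (X + Y))))
        linarith
    _ ≤ e ^ 2 * (4 * S ^ 2) := by
        rw [← Finset.mul_sum, h2]
        exact mul_le_mul_of_nonneg_left hsum (sq_nonneg e)
    _ = (2 * e * S) ^ 2 := by ring

variable {Ω : Type} [MeasurableSpace Ω] {P : Measure Ω} [IsProbabilityMeasure P]
  {g : Fin m → Ω → ℝ}

open Classical in
/-- One level of the chaining argument. -/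
lemma exists_level_bound (hn : 2 ≤ n) (hg : ∀ i, Measurable (g i)) (hind : iIndepFun g P)
    (hlaw : ∀ i, Measure.map (g i) P = gaussianReal 0 1)
    {B : Fin m → Matrix (Fin n) (Fin n) ℝ} {ι : Type} [Fintype ι]
    {k : ι → Fin m} {w : ι → ℝ} (hw : ∀ j, 0 ≤ w j)
    (h2 : ∀ X, ∑ j, w j * finner (B (k j)) X ^ 2 = ∑ i, finner (B i) X ^ 2)
    (h4 : ∀ X Y, ∑ j, w j * (finner (B (k j)) X ^ 2 * finner (B (k j)) Y ^ 2) =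
      ∑ i, finner (B i) X ^ 2 * finner (B i) Y ^ 2)
    {S E : ℝ} (hS : 0 ≤ S) (hE : 0 ≤ E) (j : ℕ) {F F' : Finset (Matrix (Fin n) (Fin n) ℝ)}
    (hF : ∀ X ∈ F, ∑ i, finner (B i) X ^ 2 ≤ S ^ 2)
    (hF' : ∀ X ∈ F', ∑ i, finner (B i) X ^ 2 ≤ S ^ 2)
    (hcard : Real.log F.card ≤ 80 * 4 ^ j * Real.log n ^ 2)
    (hcard' : Real.log F'.card ≤ 80 * 4 ^ (j + 1) * Real.log n ^ 2) :
    ∃ G : Ω → ℝ, Integrable G P ∧ ∫ ω, G ω ∂P ≤ 264 * E * S * Real.log n ∧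
      ∀ ω, ∀ X ∈ F', ∀ Y ∈ F,
        (∀ l, |finner (B (k l)) (X - Y)| ≤ 6 * (E / 2 ^ (j + 1))) →
        |quadForm B (fun i => g i ω) X - quadForm B (fun i => g i ω) Y| ≤ G ω := by
  have hlog := log_natCast_gt hn
  have hp4 : (1 : ℝ) ≤ 4 ^ j := one_le_pow₀ (by norm_num)
  let s := (F' ×ˢ F).filter fun p => ∀ l, |finner (B (k l)) (p.1 - p.2)| ≤ 6 * (E / 2 ^ (j + 1))
  have hs : Real.log (2 * (s.card : ℝ)) ≤ (11 * 2 ^ (j + 1) * Real.log n) ^ 2 := by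
    rcases Nat.eq_zero_or_pos s.card with h0 | hpos
    · rw [h0]
      simp only [Nat.cast_zero, mul_zero, Real.log_zero]
      positivity
    have hle : s.card ≤ F'.card * F.card :=
      (Finset.card_filter_le _ _).trans (Finset.card_product _ _).le
    have hprod : 0 < F'.card * F.card := lt_of_lt_of_le hpos hle
    have hpF' : (0 : ℝ) < F'.card := by exact_mod_cast Nat.pos_of_mul_pos_right hprod
    have hpF : (0 : ℝ) < F.card := by exact_mod_cast Nat.pos_of_mul_pos_left hprod
    have hpos' : (0 : ℝ) < s.card := by exact_mod_cast hpos
    have hle' : (s.card : ℝ) ≤ F'.card * F.card := by exact_mod_cast hle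
    have hl2 := Real.log_two_lt_d9
    have e4 : (4 : ℝ) ^ (j + 1) = 4 * 4 ^ j := by ring
    have e2 : ((2 : ℝ) ^ (j + 1)) ^ 2 = 4 * 4 ^ j := by
      rw [← pow_mul, mul_comm, pow_mul]; norm_num; ring
    have hl : (0.47 : ℝ) ≤ 4 ^ j * Real.log n ^ 2 := by nlinarith
    calc Real.log (2 * (s.card : ℝ)) ≤ Real.log (2 * (F'.card * F.card : ℝ)) :=
          Real.log_le_log (by positivity) (by linarith)
      _ = Real.log 2 + (Real.log F'.card + Real.log F.card) := by
          rw [Real.log_mul (by norm_num) (by positivity), Real.log_mul hpF'.ne' hpF.ne']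
      _ ≤ (11 * 2 ^ (j + 1) * Real.log n) ^ 2 := by
          rw [mul_pow, mul_pow, e2]
          rw [e4] at hcard'
          nlinarith
  obtain ⟨G, hG, hGle, hle⟩ := gaussian_max_dominated hg hind hlaw s
    (fun p i => finner (B i) p.1 ^ 2 - finner (B i) p.2 ^ 2)
    (σ := 2 * (6 * (E / 2 ^ (j + 1))) * S) (L := 11 * 2 ^ (j + 1) * Real.log n)
    (by positivity) (by positivity) hs
    (fun p hp => by
      obtain ⟨hp1, hp2⟩ := Finset.mem_filter.1 hp
      obtain ⟨hx, hy⟩ := Finset.mem_product.1 hp1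
      exact increment_variance_le hw h2 h4 (hF' _ hx) (hF _ hy) hp2)
  refine ⟨G, hG, hGle.trans (le_of_eq ?_), fun ω X hX Y hY hXY => ?_⟩
  · field_simp
    ring
  · rw [quadForm_sub]
    exact hle ω (X, Y) (Finset.mem_filter.2 ⟨Finset.mem_product.2 ⟨hX, hY⟩, hXY⟩)

/-- Entrywise comparison of the process at nearby points. -/
lemma exists_remainder_bound (hn : 2 ≤ n) (hg : ∀ i, Measurable (g i)) (hind : iIndepFun g P)
    (hlaw : ∀ i, Measure.map (g i) P = gaussianReal 0 1)
    {B : Fin m → Matrix (Fin n) (Fin n) ℝ} {K S : ℝ} (hK : 0 ≤ K) (hS : 0 ≤ S)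
    (hop : ∀ i, OpBound (B i) K) (hBS : ∀ a b, ∑ i, B i a b ^ 2 ≤ S ^ 2) :
    ∃ G : Ω → ℝ, Integrable G P ∧ ∫ ω, G ω ∂P ≤ 6 * K * S * Real.log n ∧
      ∀ ω X Y δ, (∀ a b, |X a b| ≤ 1) → (∀ a b, |Y a b| ≤ 1) →
        (∀ a b, |(X - Y) a b| ≤ δ) →
        |quadForm B (fun i => g i ω) X - quadForm B (fun i => g i ω) Y| ≤
          n ^ 4 * (2 * δ) * G ω := by
  have hlog := log_natCast_gt hn
  have hnpos : (0 : ℝ) < n := by exact_mod_cast (by omega : 0 < n)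
  have hcard : Real.log (2 * ((Finset.univ : Finset ((Fin n × Fin n) × (Fin n × Fin n))).card : ℝ))
      ≤ (3 * Real.log n) ^ 2 := by
    have hc : ((Finset.univ : Finset ((Fin n × Fin n) × (Fin n × Fin n))).card : ℝ) =
        (n : ℝ) ^ 4 := by
      simp only [Finset.card_univ, Fintype.card_prod, Fintype.card_fin]
      push_cast
      ring
    have h2 : Real.log 2 ≤ Real.log n := Real.log_le_log (by norm_num) (by exact_mod_cast hn)
    rw [hc, Real.log_mul (by norm_num) (by positivity), Real.log_pow]
    push_cast
    nlinarith
  obtain ⟨G, hG, hGle, hle⟩ := gaussian_max_dominated hg hind hlaw Finset.univ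
    (fun (p : (Fin n × Fin n) × (Fin n × Fin n)) i => B i p.1.1 p.1.2 * B i p.2.1 p.2.2)
    (σ := K * S) (L := 3 * Real.log n) (by positivity) (by positivity) hcard
    (fun p _ => by
      calc ∑ i, (B i p.1.1 p.1.2 * B i p.2.1 p.2.2) ^ 2
          ≤ ∑ i, K ^ 2 * B i p.2.1 p.2.2 ^ 2 := by
            refine Finset.sum_le_sum fun i _ => ?_
            rw [mul_pow]
            exact mul_le_mul_of_nonneg_right ((hop i).entry_sq_le _ _) (sq_nonneg _)
        _ ≤ (K * S) ^ 2 := by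
            rw [← Finset.mul_sum, mul_pow]
            exact mul_le_mul_of_nonneg_left (hBS _ _) (sq_nonneg K))
  refine ⟨G, hG, hGle.trans (le_of_eq (by ring)), fun ω X Y δ hX hY hXY => ?_⟩
  have hexp : quadForm B (fun i => g i ω) X - quadForm B (fun i => g i ω) Y =
      ∑ p : (Fin n × Fin n) × (Fin n × Fin n), (X - Y) p.1.1 p.1.2 * (X + Y) p.2.1 p.2.2 *
        ∑ i, g i ω * (B i p.1.1 p.1.2 * B i p.2.1 p.2.2) := by
    simp only [Finset.mul_sum]
    rw [quadForm_sub, Finset.sum_comm]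
    refine Finset.sum_congr rfl fun i _ => ?_
    have : finner (B i) X ^ 2 - finner (B i) Y ^ 2 =
        finner (B i) (X - Y) * finner (B i) (X + Y) := by
      rw [finner_sub_right, finner_add_right]
      ring
    rw [this, finner_eq_sum_prod, finner_eq_sum_prod, Finset.sum_mul_sum, ← Finset.sum_product',
      Finset.mul_sum]
    refine Finset.sum_congr rfl fun p _ => ?_
    ring
  rw [hexp]
  refine (Finset.abs_sum_le_sum_abs _ _).trans ?_
  have hterm : ∀ p : (Fin n × Fin n) × (Fin n × Fin n),
      |(X - Y) p.1.1 p.1.2 * (X + Y) p.2.1 p.2.2 *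
        ∑ i, g i ω * (B i p.1.1 p.1.2 * B i p.2.1 p.2.2)| ≤ 2 * δ * G ω := by
    intro p
    have h1 := hXY p.1.1 p.1.2
    have h2 : |(X + Y) p.2.1 p.2.2| ≤ 2 := by
      rw [Matrix.add_apply]
      have := abs_add_le (X p.2.1 p.2.2) (Y p.2.1 p.2.2)
      linarith [hX p.2.1 p.2.2, hY p.2.1 p.2.2]
    have h3 := hle ω p (Finset.mem_univ p)
    have hδ : 0 ≤ δ := (abs_nonneg _).trans h1
    rw [abs_mul, abs_mul, mul_comm 2 δ]
    gcongr
  refine (Finset.sum_le_card_nsmul _ _ _ fun p _ => hterm p).trans (le_of_eq ?_)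
  simp only [Finset.card_univ, Fintype.card_prod, Fintype.card_fin, nsmul_eq_mul]
  push_cast
  ring

lemma clog_two_le {n : ℕ} (hn : 2 ≤ n) : (Nat.clog 2 n : ℝ) ≤ 3 * Real.log n := by
  have hlog := log_natCast_gt hn
  have h1 : (2 : ℝ) ^ (Nat.clog 2 n - 1) ≤ n := by
    exact_mod_cast (Nat.pow_pred_clog_lt_self (by norm_num) (by omega : 1 < n)).le
  have h2 := Real.log_le_log (by positivity) h1
  rw [Real.log_pow, Nat.cast_sub (Nat.clog_pos (by norm_num) hn)] at h2
  have h3 := Real.log_two_gt_d9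
  push_cast at h2
  by_contra! hlt
  nlinarith

/-- The supremum of the quadratic Gaussian process over `D` is dominated by an integrable
function. -/
theorem exists_chaining_bound (hn : 2 ≤ n) (hm : 0 < m) (hg : ∀ i, Measurable (g i))
    (hind : iIndepFun g P) (hlaw : ∀ i, Measure.map (g i) P = gaussianReal 0 1)
    {B : Fin m → Matrix (Fin n) (Fin n) ℝ} (hB : ∀ i, (B i).IsSymm) {K R S : ℝ} (hK : 0 < K)
    (hR : 0 < R) (hS : 0 ≤ S) (hop : ∀ i, OpBound (B i) K)
    (hBS : ∀ a b, ∑ i, B i a b ^ 2 ≤ S ^ 2)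
    {D : Set (Matrix (Fin n) (Fin n) ℝ)} (hD0 : 0 ∈ D)
    (hD : ∀ X ∈ D, ∀ Y : Matrix (Fin n) (Fin n) ℝ, Y.IsSymm → ∀ b, 0 ≤ b → OpBound Y b →
      finner Y X ≤ R * b)
    (hDsymm : ∀ X ∈ D, X.IsSymm) (hDentry : ∀ X ∈ D, ∀ a b, |X a b| ≤ 1)
    (hDS : ∀ X ∈ D, ∑ i, finner (B i) X ^ 2 ≤ S ^ 2) :
    ∃ G : Ω → ℝ, Integrable G P ∧ ∫ ω, G ω ∂P ≤ 3210 * R * K * S * Real.log n ^ 2 ∧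
      ∀ ω, ∀ X ∈ D, |quadForm B (fun i => g i ω) X| ≤ G ω := by
  have hlog := log_natCast_gt hn
  have hnpos : (0 : ℝ) < n := by exact_mod_cast (by omega : 0 < n)
  obtain ⟨ι, _, k, w, hι, hw, h2, h4⟩ := exists_moment_reduction hm B
  obtain ⟨O, hOcard, hOsymm, hO0, hOneg, hOop, hBO, hEO⟩ :=
    exists_test_set hn hK (fun j => B (k j)) (fun j => hB _) (fun j => hop _) hι
  choose F hF0 hFcard hFD hFnet using
    exists_dyadic_net hn hOcard hOsymm hO0 hOneg hK hR hOop hD0 hD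
  choose G hGint hGle hG using fun j => exists_level_bound hn hg hind hlaw hw h2 h4 hS
    (by positivity : 0 ≤ K * R) j (fun X hX => hDS X (hFD j X hX))
    (fun X hX => hDS X (hFD (j + 1) X hX)) (hFcard j) (hFcard (j + 1))
  obtain ⟨H, hHint, hHle, hH⟩ := exists_remainder_bound hn hg hind hlaw hK.le hS hop hBS
  set J := 4 * Nat.clog 2 n with hJ
  have hJle : (J : ℝ) ≤ 12 * Real.log n := by
    have := clog_two_le hn
    rw [hJ]
    push_cast
    linarith
  have hJpow : (n : ℝ) ^ 4 ≤ 2 ^ J := by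
    rw [hJ, mul_comm, pow_mul]
    have : (n : ℝ) ≤ 2 ^ Nat.clog 2 n := by exact_mod_cast Nat.le_pow_clog (by norm_num) n
    gcongr
  refine ⟨fun ω => ∑ j ∈ Finset.range J, G j ω + 4 * R * H ω,
    (integrable_finsetSum _ fun j _ => hGint j).add (hHint.const_mul _), ?_, ?_⟩
  · rw [integral_add (integrable_finsetSum _ fun j _ => hGint j) (hHint.const_mul _),
      integral_finsetSum _ fun j _ => hGint j, integral_const_mul]
    have hsum : ∑ j ∈ Finset.range J, ∫ ω, G j ω ∂P ≤ J * (264 * (K * R) * S * Real.log n) := by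
      refine (Finset.sum_le_card_nsmul _ _ _ fun j _ => hGle j).trans (le_of_eq ?_)
      rw [Finset.card_range, nsmul_eq_mul]
    have hq : 0 ≤ K * R * S * Real.log n := by positivity
    have h5 := mul_le_mul_of_nonneg_right hJle hq
    have h6 := mul_le_mul_of_nonneg_left hHle (by positivity : 0 ≤ 4 * R)
    have h7 := mul_le_mul_of_nonneg_right hlog.le hq
    nlinarith
  · intro ω X hX
    choose π hπF hπ using fun j => hFnet j X hX
    set Z := quadForm B (fun i => g i ω) with hZ
    have hπ0 : π 0 = 0 := by
      have := hπF 0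
      rwa [hF0 0 rfl, Finset.mem_singleton] at this
    have hZ0 : Z (π 0) = 0 := by
      rw [hπ0, hZ, quadForm]
      exact Finset.sum_eq_zero fun i _ => by simp [finner]
    have htel : Z X = ∑ j ∈ Finset.range J, (Z (π (j + 1)) - Z (π j)) + (Z X - Z (π J)) := by
      rw [Finset.sum_range_sub (fun j => Z (π j)), hZ0]
      ring
    have hstep : ∀ j, |Z (π (j + 1)) - Z (π j)| ≤ G j ω := by
      intro j
      refine hG j ω _ (hπF (j + 1)) _ (hπF j) fun l => ?_
      have h5 := hπ (j + 1) _ (hBO l)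
      have h6 := hπ j _ (hBO l)
      have e : K * R / 2 ^ j = 2 * (K * R / 2 ^ (j + 1)) := by
        rw [pow_succ]
        field_simp
      rw [e] at h6
      have hdec : finner (B (k l)) (π (j + 1) - π j) =
          finner (B (k l)) (X - π j) - finner (B (k l)) (X - π (j + 1)) := by
        simp only [finner_sub_right]
        ring
      rw [hdec]
      refine (abs_sub _ _).trans ?_
      linarith
    have hlast : |Z X - Z (π J)| ≤ 4 * R * H ω := by
      have hπD := hFD J _ (hπF J)
      have hent : ∀ a b, |(X - π J) a b| ≤ 2 * R / n ^ 4 := by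
        intro a b
        have h5 := hπ J _ (hEO a b)
        rw [finner_smul_left, finner_symmUnit a b ((hDsymm X hX).sub (hDsymm _ hπD)), abs_mul,
          abs_of_pos hK] at h5
        have h6 : |(X - π J) a b| ≤ 2 * R / 2 ^ J := by
          refine le_of_mul_le_mul_left (h5.trans (le_of_eq ?_)) hK
          ring
        exact h6.trans (by gcongr)
      refine (hH ω X (π J) _ (hDentry X hX) (hDentry _ hπD) hent).trans (le_of_eq ?_)
      field_simp
      ring
    rw [htel]
    refine (abs_add_le _ _).trans (add_le_add ?_ hlast)
    exact (Finset.abs_sum_le_sum_abs _ _).trans (Finset.sum_le_sum fun j _ => hstep j)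

end GaussianChaining

section FrobeniusNorm

variable {n : ℕ}

lemma finner_sub_left (A B X : Matrix (Fin n) (Fin n) ℝ) :
    finner (A - B) X = finner A X - finner B X := by
  rw [finner_comm, finner_sub_right, finner_comm X, finner_comm X]

lemma finner_self_nonneg (X : Matrix (Fin n) (Fin n) ℝ) : 0 ≤ finner X X :=
  Finset.sum_nonneg fun _ _ => Finset.sum_nonneg fun _ _ => mul_self_nonneg _

lemma entry_sq_le_finner_self (X : Matrix (Fin n) (Fin n) ℝ) (a b : Fin n) :
    X a b ^ 2 ≤ finner X X := by
  rw [sq]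
  exact (Finset.single_le_sum (f := fun j => X a j * X a j) (fun j _ => mul_self_nonneg _)
    (Finset.mem_univ b)).trans
    (Finset.single_le_sum (f := fun i => ∑ j, X i j * X i j)
      (fun i _ => Finset.sum_nonneg fun _ _ => mul_self_nonneg _) (Finset.mem_univ a))

lemma finner_sq_le (A X : Matrix (Fin n) (Fin n) ℝ) :
    finner A X ^ 2 ≤ finner A A * finner X X := by
  simp only [finner_eq_sum_prod, ← sq]
  exact Finset.sum_mul_sq_le_sq_mul_sq _ _ _

lemma frobNorm_eq_sqrt (X : Matrix (Fin n) (Fin n) ℝ) : frobNorm X = Real.sqrt (finner X X) := by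
  simp only [frobNorm, finner, sq]

lemma frobNorm_le_one_iff {X : Matrix (Fin n) (Fin n) ℝ} : frobNorm X ≤ 1 ↔ finner X X ≤ 1 := by
  rw [frobNorm_eq_sqrt, Real.sqrt_le_one]

lemma finner_le_frobNorm {X : Matrix (Fin n) (Fin n) ℝ} (hX : finner X X ≤ 1)
    (N : Matrix (Fin n) (Fin n) ℝ) : finner X N ≤ frobNorm N := by
  rw [frobNorm_eq_sqrt]
  refine Real.le_sqrt_of_sq_le ((finner_sq_le X N).trans ?_)
  nlinarith [finner_self_nonneg N]

/-- The Frobenius norm is dual to itself. -/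
lemma frobNorm_le_of_forall {N : Matrix (Fin n) (Fin n) ℝ} {V : ℝ} (hV : 0 ≤ V)
    (h : ∀ Y, finner Y Y ≤ 1 → finner Y N ≤ V) : frobNorm N ≤ V := by
  rcases (finner_self_nonneg N).eq_or_lt' with h0 | hpos
  · rw [frobNorm_eq_sqrt, h0, Real.sqrt_zero]
    exact hV
  · have hs := Real.sqrt_pos.2 hpos
    have hsq := Real.mul_self_sqrt hpos.le
    rw [frobNorm_eq_sqrt]
    set s := Real.sqrt (finner N N)
    have h1 : finner (s⁻¹ • N) (s⁻¹ • N) = 1 := by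
      rw [finner_smul_left, finner_smul_right, ← hsq]
      field_simp
    have h2 : finner (s⁻¹ • N) N = s := by
      rw [finner_smul_left, ← hsq]
      field_simp
    exact h2 ▸ h _ h1.le

lemma finner_transpose (A X : Matrix (Fin n) (Fin n) ℝ) : finner Aᵀ Xᵀ = finner A X := by
  simp only [finner, transpose_apply]
  exact Finset.sum_comm

lemma finner_mul_left (A X Y : Matrix (Fin n) (Fin n) ℝ) :
    finner (A * Y) X = finner Y (Aᵀ * X) := by
  simp only [finner, mul_apply, transpose_apply, Finset.sum_mul, Finset.mul_sum]
  rw [Finset.sum_congr rfl fun i _ => Finset.sum_comm, Finset.sum_comm]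
  rw [Finset.sum_congr rfl fun k _ => Finset.sum_comm]
  refine Finset.sum_congr rfl fun k _ => Finset.sum_congr rfl fun j _ =>
    Finset.sum_congr rfl fun i _ => ?_
  ring

lemma finner_mul_right (A X Y : Matrix (Fin n) (Fin n) ℝ) :
    finner (Y * A) X = finner Y (X * Aᵀ) := by
  rw [← finner_transpose, transpose_mul, finner_mul_left, ← finner_transpose]
  simp only [transpose_mul, transpose_transpose]

lemma OpBound.finner_self_mul_le {Y : Matrix (Fin n) (Fin n) ℝ} {b : ℝ} (h : OpBound Y b)
    (Q : Matrix (Fin n) (Fin n) ℝ) : finner (Y * Q) (Y * Q) ≤ b ^ 2 * finner Q Q := by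
  have hcol : ∀ A : Matrix (Fin n) (Fin n) ℝ, finner A A = ∑ j, (A.col j) ⬝ᵥ (A.col j) :=
    fun A => Finset.sum_comm
  rw [hcol, hcol, Finset.mul_sum]
  exact Finset.sum_le_sum fun j _ => h (Q.col j)

lemma opBound_of_specNorm_le [NeZero n] {A : Matrix (Fin n) (Fin n) ℝ} {K : ℝ}
    (h : specNorm A ≤ K) : 0 ≤ K ∧ OpBound A K := by
  have hH := (Matrix.posSemidef_conjTranspose_mul_self A).1
  have hle : ∀ i, Real.sqrt (hH.eigenvalues i) ≤ K := fun i =>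
    (le_ciSup (f := fun i => Real.sqrt (hH.eigenvalues i)) (Set.finite_range _).bddAbove i).trans h
  have hK : 0 ≤ K := (Real.sqrt_nonneg _).trans (hle 0)
  refine ⟨hK, fun v => ?_⟩
  have hst : ∀ A : Matrix (Fin n) (Fin n) ℝ, star A = Aᵀ := fun A => by
    rw [star_eq_conjTranspose, conjTranspose_eq_transpose_of_trivial]
  have hs := hH.spectral_theorem
  rw [Unitary.conjStarAlgAut_apply, hst] at hs
  generalize hH.eigenvalues = d at hs hle
  set U : Matrix (Fin n) (Fin n) ℝ := (hH.eigenvectorUnitary : Matrix (Fin n) (Fin n) ℝ)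
  have hU : U * Uᵀ = 1 := by
    rw [← hst]
    exact Unitary.coe_mul_star_self _
  set w := Uᵀ *ᵥ v with hw
  have hvv : v ⬝ᵥ v = w ⬝ᵥ w := by
    rw [hw, dotProduct_mulVec, vecMul_mulVec, transpose_transpose, hU, vecMul_one]
  have hA : (A *ᵥ v) ⬝ᵥ (A *ᵥ v) = ∑ i, d i * w i ^ 2 := by
    have hdot : (A *ᵥ v) ⬝ᵥ (A *ᵥ v) = v ⬝ᵥ ((Aᴴ * A) *ᵥ v) := by
      rw [conjTranspose_eq_transpose_of_trivial, ← mulVec_mulVec, dotProduct_mulVec v,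
        vecMul_transpose]
    rw [hdot, hs, ← mulVec_mulVec, ← mulVec_mulVec, dotProduct_mulVec, ← mulVec_transpose]
    simp only [dotProduct, mulVec_diagonal, Function.comp_apply, RCLike.ofReal_real_eq_id, id_eq]
    refine Finset.sum_congr rfl fun i _ => ?_
    ring
  rw [hA, hvv, dotProduct, Finset.mul_sum]
  refine Finset.sum_le_sum fun i _ => ?_
  have h1 : d i ≤ K ^ 2 := (Real.sqrt_le_left hK).1 (hle i)
  nlinarith [mul_le_mul_of_nonneg_right h1 (sq_nonneg (w i))]

end FrobeniusNorm

section TangentProjection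

variable {n : ℕ} (M : Matrix (Fin n) (Fin n) ℝ)

lemma toEuclideanLin_colProjMat_apply (v : EuclideanSpace ℝ (Fin n)) :
    Matrix.toEuclideanLin (colProjMat M) v =
      (LinearMap.range (Matrix.toEuclideanLin M)).starProjection v := by
  rw [colProjMat, LinearEquiv.apply_symm_apply]
  rfl

lemma toEuclideanLin_mul_apply (A B : Matrix (Fin n) (Fin n) ℝ) (v : EuclideanSpace ℝ (Fin n)) :
    Matrix.toEuclideanLin (A * B) v = Matrix.toEuclideanLin A (Matrix.toEuclideanLin B v) := by
  rw [toLpLin_mul_same, LinearMap.comp_apply]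

lemma colProjMat_isSymm : (colProjMat M).IsSymm := by
  have h : (colProjMat M).IsHermitian := by
    rw [← isSymmetric_toEuclideanLin_iff]
    intro v w
    rw [toEuclideanLin_colProjMat_apply, toEuclideanLin_colProjMat_apply]
    exact Submodule.inner_starProjection_left_eq_right _ v w
  rwa [Matrix.IsHermitian, conjTranspose_eq_transpose_of_trivial] at h

lemma colProjMat_mul_self : colProjMat M * colProjMat M = colProjMat M := by
  refine Matrix.toEuclideanLin.injective (LinearMap.ext fun v => ?_)
  simp only [toEuclideanLin_mul_apply, toEuclideanLin_colProjMat_apply]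
  exact Submodule.starProjection_eq_self_iff.2 (Submodule.starProjection_apply_mem _ v)

lemma colProjMat_mul_eq : colProjMat M * M = M := by
  refine Matrix.toEuclideanLin.injective (LinearMap.ext fun v => ?_)
  rw [toEuclideanLin_mul_apply, toEuclideanLin_colProjMat_apply]
  exact Submodule.starProjection_eq_self_iff.2 (LinearMap.mem_range_self _ v)

lemma finner_colProjMat_self : finner (colProjMat M) (colProjMat M) = M.rank := by
  rw [finner_eq_trace_mul (colProjMat_isSymm M), colProjMat_mul_self]
  have hproj : LinearMap.IsProj (LinearMap.range (Matrix.toEuclideanLin M))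
      (Matrix.toEuclideanLin (colProjMat M)) := by
    refine ⟨fun v => ?_, fun v hv => ?_⟩
    · rw [toEuclideanLin_colProjMat_apply]
      exact Submodule.starProjection_apply_mem _ v
    · rw [toEuclideanLin_colProjMat_apply]
      exact Submodule.starProjection_eq_self_iff.2 hv
  have htr := hproj.trace
  rw [show (toEuclideanLin : Matrix (Fin n) (Fin n) ℝ ≃ₗ[ℝ] _) = _ from toLpLin_eq_toLin 2 2,
    Matrix.trace_toLin_eq, ← rank_eq_finrank_range_toLin] at htr
  exact htr

lemma tangentProj_idem (X : Matrix (Fin n) (Fin n) ℝ) :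
    tangentProj M (tangentProj M X) = tangentProj M X := by
  have hP := colProjMat_mul_self M
  have hQ := colProjMat_mul_self Mᵀ
  simp only [tangentProj]
  set P := colProjMat M
  set Q := colProjMat Mᵀ
  have hPl : ∀ Z : Matrix (Fin n) (Fin n) ℝ, P * (P * Z) = P * Z := fun Z => by
    rw [← mul_assoc, hP]
  simp only [mul_add, add_mul, mul_sub, sub_mul, mul_assoc, hPl, hQ]
  abel

lemma finner_tangentProj (X Y : Matrix (Fin n) (Fin n) ℝ) :
    finner (tangentProj M Y) X = finner Y (tangentProj M X) := by
  simp only [tangentProj, finner_sub_left, finner_add_left, finner_sub_right, finner_add_right]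
  rw [finner_mul_right (colProjMat Mᵀ), finner_mul_right (colProjMat Mᵀ), finner_mul_left,
    finner_mul_left, (colProjMat_isSymm M).eq, (colProjMat_isSymm Mᵀ).eq, mul_assoc]

lemma tangentProj_self : tangentProj M M = M := by
  simp only [tangentProj, colProjMat_mul_eq]
  abel

lemma finner_tangentProj_self_le (X : Matrix (Fin n) (Fin n) ℝ) :
    finner (tangentProj M X) (tangentProj M X) ≤ finner X X := by
  have h1 : finner (tangentProj M X) (tangentProj M X) = finner X (tangentProj M X) := by
    rw [finner_tangentProj, tangentProj_idem]
  have h2 := finner_self_nonneg (X - tangentProj M X)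
  rw [finner_sub_left, finner_sub_right, finner_sub_right, finner_comm (tangentProj M X) X,
    h1] at h2
  linarith

/-- Tangent vectors pair with bounded operators like matrices of low rank. -/
lemma finner_le_of_tangentProj_eq {r : ℕ} (hM : M.rank ≤ r) {X Y : Matrix (Fin n) (Fin n) ℝ}
    (hTX : tangentProj M X = X) (hX : finner X X ≤ 1) (hY : Y.IsSymm) {b : ℝ} (hb : 0 ≤ b)
    (hop : OpBound Y b) : finner Y X ≤ 2 * Real.sqrt r * b := by
  have hr : ∀ N : Matrix (Fin n) (Fin n) ℝ, N.rank ≤ r →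
      frobNorm (Y * colProjMat N) ≤ Real.sqrt r * b := by
    intro N hN
    rw [frobNorm_eq_sqrt]
    refine Real.sqrt_le_iff.2 ⟨by positivity, (hop.finner_self_mul_le _).trans ?_⟩
    rw [finner_colProjMat_self, mul_pow, Real.sq_sqrt (by positivity), mul_comm]
    gcongr
  set P := colProjMat M with hP
  set Q := colProjMat Mᵀ with hQ
  have hPX : finner (X - P * X) (X - P * X) ≤ 1 := by
    have h1 : finner (P * X) (P * X) = finner X (P * X) := by
      rw [finner_mul_left, (colProjMat_isSymm M).eq, ← mul_assoc, colProjMat_mul_self]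
    have h2 := finner_self_nonneg (P * X)
    rw [finner_sub_left, finner_sub_right, finner_sub_right, finner_comm (P * X) X, h1]
    linarith
  have hdec : finner Y X = finner Xᵀ (Y * P) + finner (X - P * X) (Y * Q) := by
    have e1 : finner Xᵀ (Y * P) = finner Y (P * X) := by
      rw [← finner_transpose, transpose_transpose, transpose_mul, hY.eq, (colProjMat_isSymm M).eq,
        finner_comm, finner_mul_left, (colProjMat_isSymm M).eq]
    have e2 : finner (X - P * X) (Y * Q) = finner Y ((X - P * X) * Q) := by
      rw [finner_comm, finner_mul_right, (colProjMat_isSymm Mᵀ).eq]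
    rw [e1, e2, ← finner_add_right]
    conv_lhs => rw [← hTX]
    rw [tangentProj, sub_mul, add_sub_assoc]
  rw [hdec]
  have h1 := (finner_le_frobNorm (by rwa [finner_transpose] : finner Xᵀ Xᵀ ≤ 1) (Y * P)).trans
    (hr M hM)
  have h2 := (finner_le_frobNorm hPX (Y * Q)).trans (hr Mᵀ (by rwa [rank_transpose]))
  linarith

end TangentProjection

section TangentBallEstimate

variable {n m : ℕ}

/-- Unit-ball elements of tangent spaces at matrices of rank at most `r`. -/
def tangentBall (n r : ℕ) : Set (Matrix (Fin n) (Fin n) ℝ) :=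
  {X | ∃ M : Matrix (Fin n) (Fin n) ℝ, M.rank ≤ r ∧ tangentProj M X = X ∧ finner X X ≤ 1}

/-- The symmetric part of a matrix. -/
def symmPart (X : Matrix (Fin n) (Fin n) ℝ) : Matrix (Fin n) (Fin n) ℝ :=
  (1 / 2 : ℝ) • (X + Xᵀ)

lemma symmPart_isSymm (X : Matrix (Fin n) (Fin n) ℝ) : (symmPart X).IsSymm := by
  rw [Matrix.IsSymm, symmPart, transpose_smul, transpose_add, transpose_transpose, add_comm]

lemma finner_symmPart {Y : Matrix (Fin n) (Fin n) ℝ} (hY : Y.IsSymm)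
    (X : Matrix (Fin n) (Fin n) ℝ) : finner Y (symmPart X) = finner Y X := by
  have h : finner Y Xᵀ = finner Y X := by
    rw [← finner_transpose, transpose_transpose, hY.eq]
  rw [symmPart, finner_smul_right, finner_add_right, h]
  ring

lemma tangentProj_mem_tangentBall {r : ℕ} {M X : Matrix (Fin n) (Fin n) ℝ} (hM : M.rank ≤ r)
    (hX : finner X X ≤ 1) : tangentProj M X ∈ tangentBall n r :=
  ⟨M, hM, tangentProj_idem M X, (finner_tangentProj_self_le M X).trans hX⟩

lemma single_mem_tangentBall {r : ℕ} (hr : 1 ≤ r) (a b : Fin n) :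
    single a b (1 : ℝ) ∈ tangentBall n r := by
  refine ⟨single a b 1, ?_, tangentProj_self _, ?_⟩
  · rw [single_eq_single_vecMulVec_single]
    exact (rank_vecMulVec_le _ _).trans hr
  · rw [finner_single, single_apply_same]

lemma finner_tangentProj_sum (M Y : Matrix (Fin n) (Fin n) ℝ) (c : Fin m → ℝ)
    (B : Fin m → Matrix (Fin n) (Fin n) ℝ) :
    finner Y (tangentProj M (∑ i, c i • B i)) = ∑ i, c i * finner (B i) (tangentProj M Y) := by
  rw [← finner_tangentProj]
  have h : ∀ s : Finset (Fin m), finner (tangentProj M Y) (∑ i ∈ s, c i • B i) =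
      ∑ i ∈ s, c i * finner (B i) (tangentProj M Y) := by
    intro s
    induction s using Finset.induction_on with
    | empty => simp [finner]
    | insert i s hi ih =>
      rw [Finset.sum_insert hi, Finset.sum_insert hi, finner_add_right, ih, finner_smul_right,
        finner_comm (B i)]
  exact h _

/-- The weak variance `sup_T √‖∑ i, P_T (B i ⟨B i, ·⟩) P_T‖` over tangent spaces. -/
def weakVariance (r : ℕ) (B : Fin m → Matrix (Fin n) (Fin n) ℝ) : ℝ :=
  ⨆ M : {M : Matrix (Fin n) (Fin n) ℝ // M.rank ≤ r},
    Real.sqrt (opNormFrob (fun X => tangentProj M.1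
      (∑ i, finner (B i) (tangentProj M.1 X) • B i)))

lemma weakVariance_nonneg (r : ℕ) (B : Fin m → Matrix (Fin n) (Fin n) ℝ) :
    0 ≤ weakVariance r B :=
  Real.iSup_nonneg fun _ => Real.sqrt_nonneg _

lemma frobNorm_compression_le (B : Fin m → Matrix (Fin n) (Fin n) ℝ)
    (M : Matrix (Fin n) (Fin n) ℝ) {X : Matrix (Fin n) (Fin n) ℝ} (hX : finner X X ≤ 1) :
    frobNorm (tangentProj M (∑ i, finner (B i) (tangentProj M X) • B i)) ≤
      ∑ i, finner (B i) (B i) := by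
  refine frobNorm_le_of_forall (Finset.sum_nonneg fun i _ => finner_self_nonneg _) fun Y hY => ?_
  rw [finner_tangentProj_sum]
  refine Finset.sum_le_sum fun i _ => ?_
  have hball : ∀ Z : Matrix (Fin n) (Fin n) ℝ, finner Z Z ≤ 1 →
      finner (B i) (tangentProj M Z) ^ 2 ≤ finner (B i) (B i) := fun Z hZ =>
    (finner_sq_le _ _).trans (mul_le_of_le_one_right (finner_self_nonneg _)
      ((finner_tangentProj_self_le M Z).trans hZ))
  nlinarith [hball X hX, hball Y hY,
    sq_nonneg (finner (B i) (tangentProj M X) - finner (B i) (tangentProj M Y))]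

lemma sum_finner_sq_le_weakVariance_sq {r : ℕ} (B : Fin m → Matrix (Fin n) (Fin n) ℝ)
    {X : Matrix (Fin n) (Fin n) ℝ} (hX : X ∈ tangentBall n r) :
    ∑ i, finner (B i) X ^ 2 ≤ weakVariance r B ^ 2 := by
  obtain ⟨M, hM, hTX, hX1⟩ := hX
  have hV : 0 ≤ ∑ i, finner (B i) (B i) := Finset.sum_nonneg fun i _ => finner_self_nonneg _
  have hcomp : ∀ (N : Matrix (Fin n) (Fin n) ℝ)
      (Z : {Z : Matrix (Fin n) (Fin n) ℝ // frobNorm Z ≤ 1}),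
      frobNorm (tangentProj N (∑ i, finner (B i) (tangentProj N Z.1) • B i)) ≤
        ∑ i, finner (B i) (B i) := fun N Z =>
    frobNorm_compression_le B N (frobNorm_le_one_iff.1 Z.2)
  have hinner : frobNorm (tangentProj M (∑ i, finner (B i) (tangentProj M X) • B i)) ≤
      opNormFrob fun X => tangentProj M (∑ i, finner (B i) (tangentProj M X) • B i) :=
    le_ciSup (f := fun Z : {Z : Matrix (Fin n) (Fin n) ℝ // frobNorm Z ≤ 1} =>
        frobNorm (tangentProj M (∑ i, finner (B i) (tangentProj M Z.1) • B i)))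
      ⟨_, Set.forall_mem_range.2 (hcomp M)⟩ ⟨X, frobNorm_le_one_iff.2 hX1⟩
  have houter : Real.sqrt (opNormFrob fun X => tangentProj M
      (∑ i, finner (B i) (tangentProj M X) • B i)) ≤ weakVariance r B :=
    le_ciSup (f := fun N : {N : Matrix (Fin n) (Fin n) ℝ // N.rank ≤ r} =>
        Real.sqrt (opNormFrob fun X => tangentProj N.1
          (∑ i, finner (B i) (tangentProj N.1 X) • B i)))
      ⟨Real.sqrt (∑ i, finner (B i) (B i)), Set.forall_mem_range.2 fun N =>
        Real.sqrt_le_sqrt (Real.iSup_le (hcomp N.1) hV)⟩ ⟨M, hM⟩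
  have hsq := (Real.sqrt_le_left (weakVariance_nonneg r B)).1 houter
  have hpair := finner_le_frobNorm hX1
    (tangentProj M (∑ i, finner (B i) (tangentProj M X) • B i))
  rw [finner_tangentProj_sum, hTX] at hpair
  rw [hTX] at hinner
  simp only [sq (finner _ _)]
  linarith

/-- The compressed operator is controlled by the quadratic process on the tangent ball. -/
lemma opNormFrob_compression_le {r : ℕ} (B : Fin m → Matrix (Fin n) (Fin n) ℝ) (t : Fin m → ℝ)
    {M : Matrix (Fin n) (Fin n) ℝ} (hM : M.rank ≤ r) {G : ℝ} (hG0 : 0 ≤ G)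
    (hG : ∀ X ∈ tangentBall n r, |quadForm B t X| ≤ G) :
    opNormFrob (fun X => tangentProj M (∑ i, (t i * finner (B i) (tangentProj M X)) • B i)) ≤
      2 * G := by
  refine Real.iSup_le (fun X => ?_) (by positivity)
  have hX := frobNorm_le_one_iff.1 X.2
  refine frobNorm_le_of_forall (by positivity) fun Y hY => ?_
  rw [finner_tangentProj_sum]
  have hpar : finner ((1 / 2 : ℝ) • (X.1 + Y)) ((1 / 2 : ℝ) • (X.1 + Y)) +
      finner ((1 / 2 : ℝ) • (X.1 - Y)) ((1 / 2 : ℝ) • (X.1 - Y)) =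
      (finner X.1 X.1 + finner Y Y) / 2 := by
    simp only [finner_smul_left, finner_smul_right, finner_add_left, finner_add_right,
      finner_sub_left, finner_sub_right]
    ring
  have hplus := finner_self_nonneg ((1 / 2 : ℝ) • (X.1 + Y))
  have hminus := finner_self_nonneg ((1 / 2 : ℝ) • (X.1 - Y))
  have h1 := abs_le.1 (hG _ (tangentProj_mem_tangentBall hM
    (by linarith : finner ((1 / 2 : ℝ) • (X.1 + Y)) ((1 / 2 : ℝ) • (X.1 + Y)) ≤ 1)))
  have h2 := abs_le.1 (hG _ (tangentProj_mem_tangentBall hM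
    (by linarith : finner ((1 / 2 : ℝ) • (X.1 - Y)) ((1 / 2 : ℝ) • (X.1 - Y)) ≤ 1)))
  have hpol : ∑ i, t i * finner (B i) (tangentProj M X.1) * finner (B i) (tangentProj M Y) =
      quadForm B t (tangentProj M ((1 / 2 : ℝ) • (X.1 + Y))) -
        quadForm B t (tangentProj M ((1 / 2 : ℝ) • (X.1 - Y))) := by
    rw [quadForm_sub]
    refine Finset.sum_congr rfl fun i _ => ?_
    simp only [← finner_tangentProj, finner_smul_right, finner_add_right, finner_sub_right]
    ring
  rw [hpol]
  linarith [h1.2, h2.1]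

variable {Ω : Type} [MeasurableSpace Ω] {P : Measure Ω} [IsProbabilityMeasure P]
  {g : Fin m → Ω → ℝ}

lemma exists_tangentBall_bound {r : ℕ} (hn : 2 ≤ n) (hr : 1 ≤ r) (hm : 0 < m)
    (hg : ∀ i, Measurable (g i)) (hind : iIndepFun g P)
    (hlaw : ∀ i, Measure.map (g i) P = gaussianReal 0 1)
    {B : Fin m → Matrix (Fin n) (Fin n) ℝ} (hB : ∀ i, (B i).IsSymm) {K : ℝ} (hK : 0 ≤ K)
    (hop : ∀ i, OpBound (B i) K) :
    ∃ G : Ω → ℝ, Integrable G P ∧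
      ∫ ω, G ω ∂P ≤ 6420 * Real.sqrt r * K * weakVariance r B * Real.log n ^ 2 ∧
      ∀ ω, ∀ X ∈ tangentBall n r, |quadForm B (fun i => g i ω) X| ≤ G ω := by
  rcases hK.eq_or_lt with rfl | hKpos
  · have hB0 : ∀ i, B i = 0 := fun i => by
      ext a b
      have := (hop i).entry_sq_le a b
      exact pow_eq_zero_iff two_ne_zero |>.1 (le_antisymm (by simpa using this) (sq_nonneg _))
    refine ⟨fun _ => 0, integrable_zero _ _ _, by simp, fun ω X _ => ?_⟩
    simp [quadForm, hB0, finner]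
  have hr0 : (0 : ℝ) < r := by exact_mod_cast hr
  have hmem0 : (0 : Matrix (Fin n) (Fin n) ℝ) ∈ tangentBall n r :=
    ⟨0, by simp, tangentProj_self 0, by simp [finner]⟩
  obtain ⟨G, hGint, hGle, hG⟩ := exists_chaining_bound hn hm hg hind hlaw hB hKpos
    (R := 2 * Real.sqrt r) (by positivity) (weakVariance_nonneg r B) hop
    (fun a b => by
      refine le_trans (le_of_eq (Finset.sum_congr rfl fun i _ => ?_))
        (sum_finner_sq_le_weakVariance_sq B (single_mem_tangentBall hr a b))
      rw [finner_comm, finner_single])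
    (D := Set.image symmPart (tangentBall n r)) ⟨0, hmem0, by simp [symmPart]⟩
    (by
      rintro _ ⟨X, ⟨M, hM, hTX, hX⟩, rfl⟩ Y hY b hb hYb
      rw [finner_symmPart hY]
      exact finner_le_of_tangentProj_eq M hM hTX hX hY hb hYb)
    (by
      rintro _ ⟨X, -, rfl⟩
      exact symmPart_isSymm X)
    (by
      rintro _ ⟨X, ⟨-, -, -, hX⟩, rfl⟩ a b
      have h1 := abs_le.1 ((sq_le_one_iff_abs_le_one _).1
        ((entry_sq_le_finner_self X a b).trans hX))
      have h2 := abs_le.1 ((sq_le_one_iff_abs_le_one _).1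
        ((entry_sq_le_finner_self X b a).trans hX))
      rw [symmPart, Matrix.smul_apply, Matrix.add_apply, transpose_apply, smul_eq_mul, abs_le]
      constructor <;> linarith [h1.1, h1.2, h2.1, h2.2])
    (by
      rintro _ ⟨X, hX, rfl⟩
      simp only [finner_symmPart (hB _)]
      exact sum_finner_sq_le_weakVariance_sq B hX)
  refine ⟨G, hGint, hGle.trans (le_of_eq (by ring)), fun ω X hX => ?_⟩
  have := hG ω _ (Set.mem_image_of_mem _ hX)
  simpa only [quadForm, finner_symmPart (hB _)] using this

end TangentBallEstimate

/-- **Lemma 8 (Gaussian supremum estimate over tangent spaces of low-rank matrices).** -/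
theorem gaussian_tangent_space_estimate :
    ∃ C : ℝ, 0 < C ∧
      ∀ (n r m : ℕ) (K : ℝ), 2 ≤ n → 1 ≤ r → 1 ≤ m → K ≤ (n : ℝ) ^ 2 →
      ∀ B : Fin m → Matrix (Fin n) (Fin n) ℝ,
      (∀ i, (B i).IsSymm) → (∀ i, specNorm (B i) ≤ K) →
      ∀ (Ω : Type) (_ : MeasurableSpace Ω) (P : Measure Ω), IsProbabilityMeasure P →
      ∀ g : Fin m → Ω → ℝ,
      (∀ i, Measurable (g i)) →
      iIndepFun (m := fun _ : Fin m => (inferInstance : MeasurableSpace ℝ)) g P →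
      (∀ i, Measure.map (g i) P = gaussianReal 0 1) →
      (∫ ω, (⨆ M : {M : Matrix (Fin n) (Fin n) ℝ // M.rank ≤ r},
          opNormFrob (fun X => tangentProj M.1
            (∑ i, (g i ω * finner (B i) (tangentProj M.1 X)) • B i))) ∂P) ≤
        C * Real.sqrt (r : ℝ) * K * Real.log (n : ℝ) ^ 3 *
          (⨆ M : {M : Matrix (Fin n) (Fin n) ℝ // M.rank ≤ r},
            Real.sqrt (opNormFrob (fun X => tangentProj M.1
              (∑ i, finner (B i) (tangentProj M.1 X) • B i)))) := by
  refine ⟨20000, by norm_num, fun n r m K hn hr hm _ B hB hspec Ω _ P hP g hg hind hlaw => ?_⟩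
  have : NeZero n := ⟨by omega⟩
  have hbound := fun i => opBound_of_specNorm_le (hspec i)
  have hK : 0 ≤ K := (hbound ⟨0, hm⟩).1
  obtain ⟨G, hGint, hGle, hG⟩ := exists_tangentBall_bound (r := r) hn hr hm hg hind hlaw hB hK
    fun i => (hbound i).2
  have hG0 : ∀ ω, 0 ≤ G ω := fun ω => (abs_nonneg _).trans
    (hG ω _ (single_mem_tangentBall hr (0 : Fin n) 0))
  have hlog := log_natCast_gt hn
  have hS := weakVariance_nonneg r B
  have hnonneg : ∀ ω, 0 ≤ ⨆ M : {M : Matrix (Fin n) (Fin n) ℝ // M.rank ≤ r},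
      opNormFrob (fun X => tangentProj M.1
        (∑ i, (g i ω * finner (B i) (tangentProj M.1 X)) • B i)) := fun ω =>
    Real.iSup_nonneg fun M => Real.iSup_nonneg fun X => Real.sqrt_nonneg _
  calc _ ≤ ∫ ω, 2 * G ω ∂P := by
        refine integral_mono_of_nonneg (Filter.Eventually.of_forall hnonneg)
          (hGint.const_mul 2) (Filter.Eventually.of_forall fun ω => ?_)
        exact Real.iSup_le (fun M => opNormFrob_compression_le B _ M.2 (hG0 ω) (hG ω))
          (mul_nonneg zero_le_two (hG0 ω))
    _ = 2 * ∫ ω, G ω ∂P := integral_const_mul _ _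
    _ ≤ 20000 * Real.sqrt r * K * Real.log n ^ 3 * weakVariance r B := by
        have hq : 0 ≤ Real.sqrt r * K * weakVariance r B * Real.log n ^ 2 := by positivity
        nlinarith [mul_le_mul_of_nonneg_right hlog.le hq]
end
end

section
/- Let a and a′ be independent random vectors in ℝ^n, each with i.i.d. entries having mean 0, variance 1, and fourth moment μ4 > 1 (all moments up to order four finite), and set B := a a^T − a′ a′^T. Then for every symmetric matrix X ∈ ℝ^{n×n}: E[ ⟨B, X⟩² ] = 4‖X‖_F² + 2(μ4 − 3)·Σ_{i=1}^n X_{ii}², and consequently E[ ⟨B, X⟩² ] ≥ min{4, 2(μ4 − 1)}·‖X‖_F². -/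
open MeasureTheory ProbabilityTheory Matrix

noncomputable section

/-- The sensing vectors `a i : Ω → (Fin n → ℝ)` have all their entries (jointly across
`i` and the coordinates) i.i.d. with common distribution `μ`. -/
def SamplingModel {Ω : Type} [MeasurableSpace Ω] (P : Measure Ω) {m n : ℕ}
    (a : Fin m → Ω → Fin n → ℝ) (μ : Measure ℝ) : Prop :=
  (∀ i j, Measurable fun ω => a i ω j) ∧
    iIndepFun (m := fun _ : Fin m × Fin n => (inferInstance : MeasurableSpace ℝ))
      (fun p ω => a p.1 ω p.2) P ∧
    ∀ i j, Measure.map (fun ω => a i ω j) P = μ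

/-- If `m` is a moment sequence with `m 0 = 1`, `m 1 = 0` and `m 2 = 1`, then the product of the
moments prescribed by the multiplicities in `(i, j, k, l)` is the sum over the three pairings,
corrected on the diagonal by the excess kurtosis `m 4 - 3`. -/
theorem prod_moment_multiplicity {ι : Type*} [Fintype ι] [DecidableEq ι] (m : ℕ → ℝ)
    (h0 : m 0 = 1) (h1 : m 1 = 0) (h2 : m 2 = 1) (i j k l : ι) :
    ∏ p, m ((if p = i then 1 else 0) + (if p = j then 1 else 0) + (if p = k then 1 else 0) +
        (if p = l then 1 else 0)) =
      (if i = j then 1 else 0) * (if k = l then 1 else 0) +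
        (if i = k then 1 else 0) * (if j = l then 1 else 0) +
        (if i = l then 1 else 0) * (if j = k then 1 else 0) +
        (m 4 - 3) * ((if i = j then 1 else 0) * (if i = k then 1 else 0) *
          (if i = l then 1 else 0)) := by
  by_cases hall : i = j ∧ i = k ∧ i = l
  · obtain ⟨rfl, rfl, rfl⟩ := hall
    rw [Finset.prod_eq_single i (fun p _ hp => by simp [hp, h0]) (by simp)]
    simp
    ring
  by_cases hi : i ≠ j ∧ i ≠ k ∧ i ≠ l
  · rw [Finset.prod_eq_zero (Finset.mem_univ i) (by simp [hi, h1])]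
    simp [hi]
  by_cases hj : j ≠ i ∧ j ≠ k ∧ j ≠ l
  · rw [Finset.prod_eq_zero (Finset.mem_univ j) (by simp [hj, h1])]
    simp [hj, hj.1.symm]
  by_cases hk : k ≠ i ∧ k ≠ j ∧ k ≠ l
  · rw [Finset.prod_eq_zero (Finset.mem_univ k) (by simp [hk, h1])]
    simp [hk, hk.1.symm, hk.2.1.symm]
  by_cases hl : l ≠ i ∧ l ≠ j ∧ l ≠ k
  · rw [Finset.prod_eq_zero (Finset.mem_univ l) (by simp [hl, h1])]
    simp [hl.1.symm, hl.2.1.symm, hl.2.2.symm]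
  rw [Finset.prod_eq_one fun p _ => ?_]
  · grind
  · split_ifs <;> grind

/-- Mixed fourth moments of independent, centered, normalized real random variables with common
fourth moment. -/
theorem integral_mul_four_of_iIndepFun {Ω ι : Type*} [MeasurableSpace Ω] [Fintype ι]
    [DecidableEq ι] {P : Measure Ω} {μ : Measure ℝ} [IsProbabilityMeasure μ] {x : ι → Ω → ℝ}
    (hx : ∀ i, Measurable (x i)) (hind : iIndepFun x P) (hmap : ∀ i, P.map (x i) = μ)
    (hmean : ∫ y, y ∂μ = 0) (hvar : ∫ y, y ^ 2 ∂μ = 1) (i j k l : ι) :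
    ∫ ω, x i ω * x j ω * x k ω * x l ω ∂P =
      (if i = j then 1 else 0) * (if k = l then 1 else 0) +
        (if i = k then 1 else 0) * (if j = l then 1 else 0) +
        (if i = l then 1 else 0) * (if j = k then 1 else 0) +
        ((∫ y, y ^ 4 ∂μ) - 3) * ((if i = j then 1 else 0) * (if i = k then 1 else 0) *
          (if i = l then 1 else 0)) := by
  rw [← prod_moment_multiplicity (fun r => ∫ y, y ^ r ∂μ) (by simp) (by simpa using hmean) hvar
    i j k l]
  have hprod : ∀ ω, x i ω * x j ω * x k ω * x l ω =
      ∏ p, x p ω ^ ((if p = i then 1 else 0) + (if p = j then 1 else 0) +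
        (if p = k then 1 else 0) + (if p = l then 1 else 0)) := fun ω => by
    simp only [pow_add, Finset.prod_mul_distrib, Finset.mem_univ, if_true, pow_ite,
      pow_one, pow_zero, Finset.prod_ite_eq']
  simp_rw [hprod]
  rw [hind.integral_fun_prod_comp
    (f := fun p y => y ^ ((if p = i then 1 else 0) + (if p = j then 1 else 0) +
        (if p = k then 1 else 0) + (if p = l then 1 else 0)))
    (fun p => (hx p).aemeasurable) (fun p => (measurable_id.pow_const _).aestronglyMeasurable)]
  refine Finset.prod_congr rfl fun p _ => ?_
  rw [← hmap p, integral_map (hx p).aemeasurable (by fun_prop)]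

theorem integrable_mul_four {Ω : Type*} [MeasurableSpace Ω] {P : Measure Ω} {f g h k : Ω → ℝ}
    (hf : Measurable f) (hg : Measurable g) (hh : Measurable h) (hk : Measurable k)
    (hf4 : Integrable (fun ω => f ω ^ 4) P) (hg4 : Integrable (fun ω => g ω ^ 4) P)
    (hh4 : Integrable (fun ω => h ω ^ 4) P) (hk4 : Integrable (fun ω => k ω ^ 4) P) :
    Integrable (fun ω => f ω * g ω * h ω * k ω) P := by
  refine (((hf4.add hg4).add hh4).add hk4).mono' (by fun_prop) (.of_forall fun ω => ?_)
  simp only [Pi.add_apply, Real.norm_eq_abs, abs_le]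
  generalize f ω = a
  generalize g ω = b
  generalize h ω = c
  generalize k ω = d
  constructor <;>
    nlinarith [sq_nonneg (a * b + c * d), sq_nonneg (a * b - c * d), sq_nonneg (a ^ 2 - b ^ 2),
      sq_nonneg (c ^ 2 - d ^ 2), sq_nonneg (a ^ 2), sq_nonneg (b ^ 2), sq_nonneg (c ^ 2),
      sq_nonneg (d ^ 2)]

/-- Second moment of a quadratic form in independent, identically distributed, centered and
normalized random variables. -/
theorem integral_quadraticForm_sq {Ω ι : Type*} [MeasurableSpace Ω] [Fintype ι]
    {P : Measure Ω} {μ : Measure ℝ} [IsProbabilityMeasure μ] {x : ι → Ω → ℝ}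
    (hx : ∀ i, Measurable (x i)) (hind : iIndepFun x P) (hmap : ∀ i, P.map (x i) = μ)
    (hmean : ∫ y, y ∂μ = 0) (hvar : ∫ y, y ^ 2 ∂μ = 1) (hmom : Integrable (fun y => y ^ 4) μ)
    {Y : Matrix ι ι ℝ} (hY : Y.IsSymm) :
    ∫ ω, (∑ i, ∑ j, Y i j * (x i ω * x j ω)) ^ 2 ∂P =
      (∑ i, Y i i) ^ 2 + 2 * ∑ i, ∑ j, Y i j ^ 2 +
        ((∫ y, y ^ 4 ∂μ) - 3) * ∑ i, Y i i ^ 2 := by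
  classical
  have hx4 : ∀ i, Integrable (fun ω => x i ω ^ 4) P := fun i =>
    Integrable.comp_measurable (f := x i) (g := fun y => y ^ 4) (by rwa [hmap i]) (hx i)
  have hint : ∀ i j k l, Integrable
      (fun ω => Y i j * Y k l * (x i ω * x j ω * x k ω * x l ω)) P := fun i j k l =>
    (integrable_mul_four (hx i) (hx j) (hx k) (hx l) (hx4 i) (hx4 j) (hx4 k)
      (hx4 l)).const_mul _
  have hexpand : ∀ ω, (∑ i, ∑ j, Y i j * (x i ω * x j ω)) ^ 2 =
      ∑ i, ∑ j, ∑ k, ∑ l, Y i j * Y k l * (x i ω * x j ω * x k ω * x l ω) := fun ω => by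
    simp_rw [sq, Finset.sum_mul, Finset.mul_sum]
    refine Finset.sum_congr rfl fun i _ => Finset.sum_congr rfl fun j _ =>
      Finset.sum_congr rfl fun k _ => Finset.sum_congr rfl fun l _ => ?_
    ring
  have hintegral : ∫ ω, (∑ i, ∑ j, Y i j * (x i ω * x j ω)) ^ 2 ∂P =
      ∑ i, ∑ j, ∑ k, ∑ l, Y i j * Y k l * ∫ ω, x i ω * x j ω * x k ω * x l ω ∂P := by
    simp_rw [hexpand]
    rw [integral_finsetSum _ fun i _ => integrable_finsetSum _ fun j _ =>
      integrable_finsetSum _ fun k _ => integrable_finsetSum _ fun l _ => hint i j k l]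
    refine Finset.sum_congr rfl fun i _ => ?_
    rw [integral_finsetSum _ fun j _ => integrable_finsetSum _ fun k _ =>
      integrable_finsetSum _ fun l _ => hint i j k l]
    refine Finset.sum_congr rfl fun j _ => ?_
    rw [integral_finsetSum _ fun k _ => integrable_finsetSum _ fun l _ => hint i j k l]
    refine Finset.sum_congr rfl fun k _ => ?_
    rw [integral_finsetSum _ fun l _ => hint i j k l]
    exact Finset.sum_congr rfl fun l _ => integral_const_mul _ _
  rw [hintegral]
  simp_rw [integral_mul_four_of_iIndepFun hx hind hmap hmean hvar, mul_add,
    Finset.sum_add_distrib]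
  have hpair : ∑ i, ∑ j, ∑ k, ∑ l, Y i j * Y k l *
      ((if i = j then 1 else 0) * (if k = l then 1 else 0)) = (∑ i, Y i i) ^ 2 := by
    simp_rw [mul_mul_mul_comm (Y _ _) (Y _ _), ← Finset.mul_sum, ← Finset.sum_mul]
    simp [sq]
  have hcross : ∑ i, ∑ j, ∑ k, ∑ l, Y i j * Y k l *
      ((if i = k then 1 else 0) * (if j = l then 1 else 0)) = ∑ i, ∑ j, Y i j ^ 2 := by
    simp [sq]
  have hswap : ∑ i, ∑ j, ∑ k, ∑ l, Y i j * Y k l *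
      ((if i = l then 1 else 0) * (if j = k then 1 else 0)) = ∑ i, ∑ j, Y i j ^ 2 := by
    exact Finset.sum_congr rfl fun i _ => Finset.sum_congr rfl fun j _ => by
      simp [hY.apply i j, sq]
  have hdiag : ∑ i, ∑ j, ∑ k, ∑ l, Y i j * Y k l * (((∫ y, y ^ 4 ∂μ) - 3) *
      ((if i = j then 1 else 0) * (if i = k then 1 else 0) * (if i = l then 1 else 0))) =
      ((∫ y, y ^ 4 ∂μ) - 3) * ∑ i, Y i i ^ 2 := by
    simp [sq, mul_comm, Finset.sum_mul]
  rw [hpair, hcross, hswap, hdiag]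
  ring

/-- **Lemma (second moment of the debiased rank-one measurements).** -/
theorem debiased_second_moment
    {n : ℕ} (Ω : Type) [MeasurableSpace Ω] (P : Measure Ω) [IsProbabilityMeasure P]
    (μ : Measure ℝ) [IsProbabilityMeasure μ]
    (hmom : ∀ k : ℕ, k ≤ 4 → Integrable (fun x => x ^ k) μ)
    (hmean : (∫ x, x ∂μ) = 0) (hvar : (∫ x, x ^ 2 ∂μ) = 1)
    (μ4 : ℝ) (hμ4def : μ4 = ∫ x, x ^ 4 ∂μ) (hμ4 : 1 < μ4)
    (a : Fin 2 → Ω → Fin n → ℝ) (ha : SamplingModel P a μ)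
    (B : Ω → Matrix (Fin n) (Fin n) ℝ)
    (hB : ∀ ω, B ω =
      Matrix.vecMulVec (a 0 ω) (a 0 ω) - Matrix.vecMulVec (a 1 ω) (a 1 ω)) :
    ∀ X : Matrix (Fin n) (Fin n) ℝ, X.IsSymm →
      (∫ ω, finner (B ω) X ^ 2 ∂P) =
          4 * frobNorm X ^ 2 + 2 * (μ4 - 3) * ∑ i, X i i ^ 2 ∧
      min 4 (2 * (μ4 - 1)) * frobNorm X ^ 2 ≤ ∫ ω, finner (B ω) X ^ 2 ∂P := by
  intro X hX
  obtain ⟨hmeas, hind, hmap⟩ := ha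
  have hfrob : frobNorm X ^ 2 = ∑ i, ∑ j, X i j ^ 2 := Real.sq_sqrt (by positivity)
  -- `⟨B, X⟩` is the quadratic form of `diag(X, -X)` in the concatenation of the two vectors.
  let Y : Matrix (Fin 2 × Fin n) (Fin 2 × Fin n) ℝ :=
    Matrix.kronecker (Matrix.diagonal ![1, -1]) X
  have hY : Y.IsSymm := by
    ext p q
    simp [Y, Matrix.kroneckerMap_apply, hX.apply, Matrix.diagonal_apply]
    grind
  have hquad : ∀ ω, finner (B ω) X =
      ∑ p, ∑ q, Y p q * (a p.1 ω p.2 * a q.1 ω q.2) := fun ω => by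
    simp [Y, finner, hB, Matrix.vecMulVec_apply, Fintype.sum_prod_type,
      Finset.sum_neg_distrib, mul_comm (X _ _), sub_eq_add_neg,
      Finset.sum_add_distrib, add_mul]
  have hmain : ∫ ω, finner (B ω) X ^ 2 ∂P =
      4 * frobNorm X ^ 2 + 2 * (μ4 - 3) * ∑ i, X i i ^ 2 := by
    simp_rw [hquad]
    rw [integral_quadraticForm_sq (x := fun p ω => a p.1 ω p.2) (fun p => hmeas p.1 p.2) hind
      (fun p => hmap p.1 p.2) hmean hvar (hmom 4 le_rfl) hY, hfrob, hμ4def]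
    simp [Y, Fintype.sum_prod_type]
    ring
  have hdiag : ∑ i, X i i ^ 2 ≤ ∑ i, ∑ j, X i j ^ 2 := Finset.sum_le_sum fun i _ =>
    Finset.single_le_sum (f := fun j => X i j ^ 2) (fun j _ => sq_nonneg _) (Finset.mem_univ i)
  have hdiag_nonneg : 0 ≤ ∑ i, X i i ^ 2 := by positivity
  refine ⟨hmain, ?_⟩
  rw [hmain, hfrob]
  rcases le_total 3 μ4 with h | h
  · rw [min_eq_left (by linarith)]
    nlinarith
  · rw [min_eq_right (by linarith)]
    nlinarith
end
end
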